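/- arXiv:2311.15655 — 5 statements merged into one kernel-verified Lean document; each statement's English description precedes it below -/
import Mathlib

section
/- Suppose u is strictly convex in Ω, meaning there is no nondegenerate closed segment meeting Ω on which u is affine. Then for every x ∈ Ω and every y ∈ ∂⁻u(x), the Legendre transform v is differentiable at y and ∇v(y) = x. -/
open MeasureTheory Metric Set
open scoped NNReal ENNReal RealInnerProductSpace

noncomputable section

abbrev E2 : Type := EuclideanSpace ℝ (Fin 2)

/-- The subdifferential of a convex function `w` at a point `x`. -/
def subdiff (w : E2 → ℝ) (x : E2) : Set E2 :=
  {p : E2 | ∀ z : E2, w x + ⟪p, z - x⟫ ≤ w z}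

/-- A convex function on a finite-dimensional space vanishing at `x` and positive elsewhere grows
at least linearly away from `x`. -/
lemma ConvexOn.exists_linear_growth {E : Type*} [NormedAddCommGroup E] [NormedSpace ℝ E]
    [FiniteDimensional ℝ E] {f : E → ℝ} (hf : ConvexOn ℝ Set.univ f) {x : E} (hx : f x = 0)
    (hpos : ∀ z, z ≠ x → 0 < f z) {r : ℝ} (hr : 0 < r) :
    ∃ δ > 0, ∀ z, r ≤ ‖z - x‖ → δ * ‖z - x‖ ≤ f z := by
  have hradial : ∀ z, r ≤ ‖z - x‖ → ∃ w ∈ sphere x r, f w ≤ r / ‖z - x‖ * f z := by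
    intro z hz
    have hn : 0 < ‖z - x‖ := hr.trans_le hz
    have ht0 : 0 ≤ r / ‖z - x‖ := by positivity
    have ht1 : r / ‖z - x‖ ≤ 1 := (div_le_one hn).2 hz
    refine ⟨x + (r / ‖z - x‖) • (z - x), ?_, ?_⟩
    · rw [mem_sphere, dist_eq_norm, add_sub_cancel_left, norm_smul, Real.norm_of_nonneg ht0,
        div_mul_cancel₀ _ hn.ne']
    · have h := hf.2 (mem_univ x) (mem_univ z) (sub_nonneg.2 ht1) ht0 (by ring)
      have he : (1 - r / ‖z - x‖) • x + (r / ‖z - x‖) • z = x + (r / ‖z - x‖) • (z - x) := by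
        module
      rwa [he, hx, smul_zero, zero_add, smul_eq_mul] at h
  rcases (sphere x r).eq_empty_or_nonempty with hs | hs
  · refine ⟨1, one_pos, fun z hz => ?_⟩
    obtain ⟨w, hw, -⟩ := hradial z hz
    simp [hs] at hw
  · obtain ⟨w₀, hw₀, hmin⟩ :=
      (isCompact_sphere x r).exists_isMinOn hs hf.locallyLipschitz.continuous.continuousOn
    have hm : 0 < f w₀ := hpos w₀ (ne_of_mem_sphere hw₀ hr.ne')
    refine ⟨f w₀ / r, by positivity, fun z hz => ?_⟩
    obtain ⟨w, hw, hwz⟩ := hradial z hz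
    have hn : 0 < ‖z - x‖ := hr.trans_le hz
    have h : f w₀ ≤ r / ‖z - x‖ * f z := (isMinOn_iff.1 hmin w hw).trans hwz
    rw [div_mul_eq_mul_div, le_div_iff₀ hn] at h
    rw [div_mul_eq_mul_div, div_le_iff₀ hr]
    linarith

/-- The Legendre transform `v` of `u` has gradient `x` at `y` if, for every `r > 0`, the excess of
`u` over the affine function of slope `y` through `(x, u x)` grows at least linearly outside the
ball of radius `r` around `x`. -/
lemma hasGradientAt_legendre_of_linear_growth {E : Type*} [NormedAddCommGroup E]
    [InnerProductSpace ℝ E] [CompleteSpace E] {u v : E → ℝ}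
    (hv : ∀ y, IsLUB {c : ℝ | ∃ x : E, c = ⟪x, y⟫ - u x} (v y)) {x y : E}
    (hy : ∀ z, u x + ⟪y, z - x⟫ ≤ u z)
    (hgrowth : ∀ r > 0, ∃ δ > 0, ∀ z, r ≤ ‖z - x‖ →
      δ * ‖z - x‖ ≤ u z - u x - ⟪y, z - x⟫) :
    HasGradientAt v x y := by
  have hvy : v y = ⟪x, y⟫ - u x := by
    refine (hv y).unique (IsGreatest.isLUB ⟨⟨x, rfl⟩, ?_⟩)
    rintro _ ⟨z, rfl⟩
    have h := hy z
    rw [inner_sub_right, real_inner_comm z y, real_inner_comm x y] at h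
    linarith
  rw [hasGradientAt_iff_isLittleO_nhds_zero, Asymptotics.isLittleO_iff]
  intro r hr
  obtain ⟨δ, hδ, hgrow⟩ := hgrowth r hr
  filter_upwards [ball_mem_nhds (0 : E) hδ] with h hh
  rw [mem_ball_zero_iff] at hh
  have hlower : ⟪x, y + h⟫ - u x ≤ v (y + h) := (hv (y + h)).1 ⟨x, rfl⟩
  have hupper : v (y + h) ≤ ⟪x, y + h⟫ - u x + r * ‖h‖ := by
    refine (hv (y + h)).2 ?_
    rintro _ ⟨z, rfl⟩
    have hexcess : ⟪z - x, h⟫ - (u z - u x - ⟪y, z - x⟫) ≤ r * ‖h‖ := by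
      have hcs := real_inner_le_norm (z - x) h
      rcases le_total r ‖z - x‖ with hz | hz
      · have := hgrow z hz
        have := mul_le_mul_of_nonneg_left hh.le (norm_nonneg (z - x))
        have : 0 ≤ r * ‖h‖ := by positivity
        linarith
      · have := hy z
        have := mul_le_mul_of_nonneg_right hz (norm_nonneg h)
        linarith
    rw [inner_sub_left, inner_sub_right, real_inner_comm z y, real_inner_comm x y] at hexcess
    rw [inner_add_right, inner_add_right]
    linarith
  rw [inner_add_right] at hlower hupper
  rw [hvy, Real.norm_eq_abs, abs_le]
  have : 0 ≤ r * ‖h‖ := by positivity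
  constructor <;> linarith

/-- if `u` is strictly convex in an open set `Ω` (no nondegenerate closed
segment meeting `Ω` on which `u` is affine), then for every `x ∈ Ω` and every
`y ∈ ∂⁻u(x)`, the Legendre transform `v` is differentiable at `y` with `∇v(y) = x`. -/
theorem legendre_differentiable_on_subdifferential
    (u v : E2 → ℝ) (hconv : ConvexOn ℝ Set.univ u)
    (hv : ∀ y : E2, IsLUB {c : ℝ | ∃ x : E2, c = ⟪x, y⟫ - u x} (v y))
    (Ω : Set E2) (hΩo : IsOpen Ω)
    (hstrict : ¬ ∃ a b : E2, a ≠ b ∧ (segment ℝ a b ∩ Ω).Nonempty ∧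
      ∃ (p : E2) (c : ℝ), ∀ z ∈ segment ℝ a b, u z = ⟪p, z⟫ + c) :
    ∀ x ∈ Ω, ∀ y ∈ subdiff u x, HasGradientAt v x y := by
  intro x hx y hy
  have hfconv : ConvexOn ℝ Set.univ fun z => u z - u x - ⟪y, z - x⟫ := by
    refine ⟨convex_univ, fun a _ b _ s t hs ht hst => ?_⟩
    have h := hconv.2 (mem_univ a) (mem_univ b) hs ht hst
    simp only [smul_eq_mul, inner_sub_right, inner_add_right, real_inner_smul_right] at h ⊢
    obtain rfl : s = 1 - t := by linarith
    linarith
  refine hasGradientAt_legendre_of_linear_growth hv hy fun r hr =>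
    hfconv.exists_linear_growth (by simp) (fun z hz => ?_) hr
  have hz0 : 0 ≤ u z - u x - ⟪y, z - x⟫ := by linarith [hy z]
  refine hz0.lt_of_ne' fun hzero => hstrict
    ⟨x, z, hz.symm, ⟨x, left_mem_segment ℝ x z, hx⟩, y, u x - ⟪y, x⟫, fun w hw => ?_⟩
  have hle := hfconv.le_on_segment (mem_univ x) (mem_univ z) hw
  have hge := hy w
  simp only [sub_self, inner_zero_right, hzero, max_self] at hle
  rw [inner_sub_right] at hle hge
  linarith
end
end

section
/- The set Ω' := {x ∈ Ω : ∂⁻u(x) ∩ Ω* ≠ ∅} is open, |Ω \ Ω'| = 0, and u is C^∞ and strictly convex in Ω'. Consequently the singular set satisfies A ⊂ Ω \ Ω'. -/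
open MeasureTheory Metric Set
open scoped NNReal ENNReal RealInnerProductSpace

noncomputable section

section Subgradient

variable {E : Type*} [NormedAddCommGroup E] [InnerProductSpace ℝ E]

/-- The set of subgradients of `w` at `x` in a real inner product space. -/
def subgrad (w : E → ℝ) (x : E) : Set E :=
  {p : E | ∀ z : E, w x + ⟪p, z - x⟫ ≤ w z}

/-- `T` is the resolvent of the subdifferential of `w`. -/
def IsResolvent (w : E → ℝ) (T : E → E) : Prop :=
  ∀ y, y - T y ∈ subgrad w (T y)

theorem subgrad_monotone {w : E → ℝ} {x y p q : E} (hp : p ∈ subgrad w x)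
    (hq : q ∈ subgrad w y) : 0 ≤ ⟪p - q, x - y⟫ := by
  have h1 := hp y
  have h2 := hq x
  have h3 : ⟪p, y - x⟫ = -⟪p, x - y⟫ := by rw [← inner_neg_right, neg_sub]
  rw [inner_sub_left]
  linarith

theorem hasFDerivAt_of_abs_sub_le {f : E → ℝ} {L : E →L[ℝ] ℝ} {x : E} {c : E → ℝ}
    (hc : Filter.Tendsto c (nhds x) (nhds 0))
    (h : ∀ᶠ y in nhds x, |f y - f x - L (y - x)| ≤ c y * ‖y - x‖) : HasFDerivAt f L x := by
  rw [hasFDerivAt_iff_isLittleO, Asymptotics.isLittleO_iff]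
  intro ε hε
  filter_upwards [h, hc.eventually (gt_mem_nhds hε)] with y hy hcy
  rw [Real.norm_eq_abs]
  exact hy.trans (mul_le_mul_of_nonneg_right hcy.le (norm_nonneg _))

theorem hasFDerivAt_of_subgrad_selection {w : E → ℝ} {q : E → E} {x : E} (hq : ContinuousAt q x)
    (h : ∀ᶠ y in nhds x, q y ∈ subgrad w y) : HasFDerivAt w (innerSL ℝ (q x)) x := by
  refine hasFDerivAt_of_abs_sub_le (c := fun y => ‖q y - q x‖) ?_ ?_
  · have := (hq.sub (continuousAt_const (y := q x))).norm
    simpa using this.tendsto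
  · filter_upwards [h] with y hy
    have h1 := h.self_of_nhds y
    have h2 := hy x
    have h3 : ⟪q y, x - y⟫ = -⟪q y - q x, y - x⟫ - ⟪q x, y - x⟫ := by
      rw [inner_sub_left, ← neg_sub y x, inner_neg_right]; ring
    have h4 := real_inner_le_norm (q y - q x) (y - x)
    rw [innerSL_apply_apply, abs_le]
    constructor
    · have : 0 ≤ ‖q y - q x‖ * ‖y - x‖ := by positivity
      linarith
    · linarith

theorem mem_subgrad_of_isMin_add_sq {w : E → ℝ} (hw : ConvexOn ℝ univ w) {x y : E}
    (hmin : ∀ z, w x + ‖x - y‖ ^ 2 / 2 ≤ w z + ‖z - y‖ ^ 2 / 2) :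
    y - x ∈ subgrad w x := by
  intro z
  by_contra! hlt
  set c := w x + ⟪y - x, z - x⟫ - w z with hc
  have hcpos : 0 < c := by linarith
  set n := ‖z - x‖ ^ 2 with hn
  have hn0 : 0 ≤ n := by positivity
  set t := c / (c + n) with ht
  have htpos : 0 < t := by positivity
  have ht1 : t ≤ 1 := by rw [ht, div_le_one (by positivity)]; linarith
  have h1 := hmin ((1 - t) • x + t • z)
  have h2 := hw.2 (mem_univ x) (mem_univ z) (sub_nonneg.2 ht1) htpos.le (by ring)
  have h3 : (1 - t) • x + t • z - y = (x - y) + t • (z - x) := by module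
  have h4 : ‖(x - y) + t • (z - x)‖ ^ 2 = ‖x - y‖ ^ 2 - 2 * t * ⟪y - x, z - x⟫ + t ^ 2 * n := by
    rw [norm_add_sq_real, inner_smul_right, norm_smul, ← neg_sub y x, inner_neg_left,
      mul_pow, Real.norm_eq_abs, sq_abs, norm_neg]
    ring
  rw [h3, h4] at h1
  simp only [smul_eq_mul] at h2
  have h5 : t * c ≤ t * (t * n / 2) := by rw [hc]; nlinarith
  have h6 : c ≤ t * n / 2 := le_of_mul_le_mul_left h5 htpos
  have h7 : t * (c + n) = c := by rw [ht]; field_simp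
  nlinarith

theorem exists_isResolvent [FiniteDimensional ℝ E] {w : E → ℝ} (hw : ConvexOn ℝ univ w) {K : ℝ≥0}
    (hL : LipschitzWith K w) : ∃ T : E → E, IsResolvent w T := by
  have : ∀ y, ∃ x, y - x ∈ subgrad w x := by
    intro y
    have hcont : Continuous fun x => w x + ‖x - y‖ ^ 2 / 2 := by
      have := hL.continuous
      fun_prop
    obtain ⟨x, hx⟩ := hcont.exists_forall_le' y (by
      filter_upwards [(isCompact_closedBall y (2 * K)).compl_mem_cocompact] with x hx
      simp only [mem_compl_iff, mem_closedBall, not_le] at hx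
      have h1 := hL.dist_le_mul x y
      rw [Real.dist_eq] at h1
      have h2 := (abs_le.1 h1).1
      rw [dist_eq_norm] at hx h2
      have hK : (0 : ℝ) ≤ K := K.2
      simp only [sub_self, norm_zero]
      nlinarith)
    exact ⟨x, mem_subgrad_of_isMin_add_sq hw hx⟩
  choose T hT using this
  exact ⟨T, hT⟩

namespace IsResolvent

variable {w : E → ℝ} {T : E → E}

theorem inner_sub_nonneg (hT : IsResolvent w T) (y z : E) :
    0 ≤ ⟪(y - T y) - (z - T z), T y - T z⟫ :=
  subgrad_monotone (hT y) (hT z)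

theorem norm_sq_ge (hT : IsResolvent w T) (y z : E) :
    ‖T y - T z‖ ^ 2 + ‖(y - T y) - (z - T z)‖ ^ 2 ≤ ‖y - z‖ ^ 2 := by
  have h := hT.inner_sub_nonneg y z
  have h1 : y - z = ((y - T y) - (z - T z)) + (T y - T z) := by abel
  rw [h1, norm_add_sq_real]
  linarith

theorem lipschitzWith (hT : IsResolvent w T) : LipschitzWith 1 T := by
  refine LipschitzWith.of_dist_le_mul fun y z => ?_
  rw [dist_eq_norm, dist_eq_norm, NNReal.coe_one, one_mul]
  refine (sq_le_sq₀ (norm_nonneg _) (norm_nonneg _)).1 ?_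
  linarith [hT.norm_sq_ge y z, sq_nonneg ‖(y - T y) - (z - T z)‖]

theorem lipschitzWith_sub (hT : IsResolvent w T) : LipschitzWith 1 fun y => y - T y := by
  refine LipschitzWith.of_dist_le_mul fun y z => ?_
  rw [dist_eq_norm, dist_eq_norm, NNReal.coe_one, one_mul]
  refine (sq_le_sq₀ (norm_nonneg _) (norm_nonneg _)).1 ?_
  linarith [hT.norm_sq_ge y z, sq_nonneg ‖T y - T z‖]

theorem inner_apply_sub_nonneg (hT : IsResolvent w T) (y z : E) : 0 ≤ ⟪T y - T z, y - z⟫ := by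
  have h := hT.inner_sub_nonneg y z
  have h1 : y - z = ((y - T y) - (z - T z)) + (T y - T z) := by abel
  rw [h1, inner_add_right, real_inner_self_eq_norm_sq, real_inner_comm]
  positivity

theorem inner_residual_sub_nonneg (hT : IsResolvent w T) (y z : E) :
    0 ≤ ⟪(y - T y) - (z - T z), y - z⟫ := by
  have h := hT.inner_sub_nonneg y z
  have h1 : ⟪(y - T y) - (z - T z), y - z⟫ =
      ‖(y - T y) - (z - T z)‖ ^ 2 + ⟪(y - T y) - (z - T z), T y - T z⟫ := by
    rw [← real_inner_self_eq_norm_sq, ← inner_add_right]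
    congr 1
    abel
  rw [h1]
  positivity

theorem apply_add (hT : IsResolvent w T) {x p : E} (hp : p ∈ subgrad w x) : T (x + p) = x := by
  have h := subgrad_monotone (hT (x + p)) hp
  have h1 : x + p - T (x + p) - p = -(T (x + p) - x) := by abel
  rw [h1, inner_neg_left, real_inner_self_eq_norm_sq] at h
  have h2 : ‖T (x + p) - x‖ = 0 := by nlinarith [norm_nonneg (T (x + p) - x)]
  exact sub_eq_zero.1 (norm_eq_zero.1 h2)

theorem hasFDerivAt_moreau (hT : IsResolvent w T) (y : E) :
    HasFDerivAt (fun y => w (T y) + ‖y - T y‖ ^ 2 / 2) (innerSL ℝ (y - T y)) y := by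
  have key : ∀ y z, w (T z) + ‖z - T z‖ ^ 2 / 2 ≤
      w (T y) + ‖y - T y‖ ^ 2 / 2 + ⟪y - T y, z - y⟫ + ‖z - y‖ ^ 2 / 2 := by
    intro y z
    have h1 := hT z (T y)
    have h2 : ‖(y - T y) + (z - y)‖ ^ 2 = _ := norm_add_sq_real (y - T y) (z - y)
    have h3 : (y - T y) + (z - y) = (z - T z) - (T y - T z) := by abel
    rw [h3, norm_sub_sq_real] at h2
    nlinarith [sq_nonneg ‖T y - T z‖]
  refine hasFDerivAt_of_abs_sub_le (c := fun z => ‖z - y‖ / 2) ?_ (Filter.Eventually.of_forall ?_)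
  · have : ContinuousAt (fun z => ‖z - y‖ / 2) y := by fun_prop
    simpa [ContinuousAt] using this
  · intro z
    have h1 := key y z
    have h2 := key z y
    have h3 : ⟪z - T z, y - z⟫ = -⟪(z - T z) - (y - T y), z - y⟫ - ⟪y - T y, z - y⟫ := by
      rw [inner_sub_left (z - T z), ← neg_sub z y, inner_neg_right]; ring
    have h4 := hT.inner_residual_sub_nonneg z y
    rw [norm_sub_rev y z] at h2
    rw [innerSL_apply_apply, abs_le]
    constructor <;> nlinarith

theorem inner_fderiv_symm (hT : IsResolvent w T) {y : E} (hd : DifferentiableAt ℝ T y) (v z : E) :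
    ⟪fderiv ℝ T y v, z⟫ = ⟪fderiv ℝ T y z, v⟫ := by
  have h1 : HasFDerivAt (fun y => innerSL ℝ (y - T y))
      ((innerSL ℝ).comp (ContinuousLinearMap.id ℝ E - fderiv ℝ T y)) y :=
    (innerSL ℝ (E := E)).hasFDerivAt.comp y ((hasFDerivAt_id y).sub hd.hasFDerivAt)
  have h2 := second_derivative_symmetric hT.hasFDerivAt_moreau h1 v z
  simp only [ContinuousLinearMap.comp_apply, _root_.sub_apply, innerSL_apply_apply,
    ContinuousLinearMap.id_apply, inner_sub_left] at h2
  have h3 := real_inner_comm v z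
  linarith

end IsResolvent

end Subgradient

section StrictConvexity

theorem Complex.real_inner_eq (z w : ℂ) : ⟪z, w⟫ = z.re * w.re + z.im * w.im := by
  simp only [Complex.inner, Complex.mul_re, Complex.conj_re, Complex.conj_im]
  ring

theorem flat_convex_estimate {g : ℂ → ℝ} (hg : ConvexOn ℝ univ g) (hg0 : ∀ z, 0 ≤ g z) {r : ℝ}
    (hr : 0 < r) (hz : ∀ s : ℝ, |s| ≤ r → g s = 0) {ε : ℝ} (hε : 0 < ε) :
    ∃ α h : ℝ, 0 < h ∧ h ≤ r ∧ ∀ s t : ℝ, |s| ≤ r / 2 → 0 < t → t ≤ h →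
      α * t ≤ g ⟨s, t⟩ ∧ g ⟨s, t⟩ ≤ (α + ε) * t := by
  set A : Set ℝ := {y | ∃ s t : ℝ, |s| ≤ r ∧ 0 < t ∧ y = g ⟨s, t⟩ / t} with hA
  have hbdd : BddBelow A := ⟨0, by
    rintro y ⟨s, t, -, ht, rfl⟩
    exact div_nonneg (hg0 _) ht.le⟩
  have hne : A.Nonempty := ⟨_, 0, 1, by simpa using hr.le, one_pos, rfl⟩
  obtain ⟨_, ⟨s₁, t₁, hs₁, ht₁, rfl⟩, hlt⟩ :=
    exists_lt_of_csInf_lt hne (lt_add_of_pos_right (sInf A) hε)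
  rw [div_lt_iff₀ ht₁] at hlt
  refine ⟨sInf A, min (t₁ / 4) r, by positivity, min_le_right _ _, fun s t hs ht hth => ⟨?_, ?_⟩⟩
  · rw [← le_div_iff₀ ht]
    exact csInf_le hbdd ⟨s, t, by linarith, ht, rfl⟩
  · have hth' : t ≤ t₁ / 4 := hth.trans (min_le_left _ _)
    set l := t / t₁ with hl
    have hlt₁ : l * t₁ = t := by rw [hl]; field_simp
    have hl0 : 0 < l := by positivity
    have hl1 : l ≤ 1 / 4 := by rw [hl, div_le_iff₀ ht₁]; linarith
    have hpos : 0 < 1 - l := by linarith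
    set s₀ := (s - l * s₁) / (1 - l) with hs₀
    have hs₀' : (1 - l) * s₀ = s - l * s₁ := by rw [hs₀]; field_simp
    have habs : |s₀| ≤ r := by
      rw [hs₀, abs_div, abs_of_pos hpos, div_le_iff₀ hpos]
      have h1 := abs_sub s (l * s₁)
      rw [abs_mul, abs_of_pos hl0] at h1
      nlinarith
    have h := hg.2 (mem_univ (s₀ : ℂ)) (mem_univ (⟨s₁, t₁⟩ : ℂ)) hpos.le hl0.le (by ring)
    have heq : (1 - l) • (s₀ : ℂ) + l • (⟨s₁, t₁⟩ : ℂ) = ⟨s, t⟩ := by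
      apply Complex.ext
      · simp only [Complex.add_re, Complex.real_smul, Complex.re_ofReal_mul, Complex.ofReal_re]
        linarith
      · simp only [Complex.add_im, Complex.real_smul, Complex.im_ofReal_mul, Complex.ofReal_im]
        linarith
    rw [heq, hz s₀ habs, smul_eq_mul, smul_eq_mul, mul_zero, zero_add] at h
    calc g ⟨s, t⟩ ≤ l * g ⟨s₁, t₁⟩ := h
      _ ≤ l * ((sInf A + ε) * t₁) := mul_le_mul_of_nonneg_left hlt.le hl0.le
      _ = (sInf A + ε) * t := by rw [← hlt₁]; ring

theorem exists_subgrad_image_small {g : ℂ → ℝ} (hg : ConvexOn ℝ univ g) (hg0 : ∀ z, 0 ≤ g z) {r : ℝ}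
    (hr : 0 < r) (hz : ∀ s : ℝ, |s| ≤ r → g s = 0) :
    ∃ R Q : Set ℂ, MeasurableSet R ∧ MeasurableSet Q ∧ R ⊆ ball 0 (2 * r) ∧
      volume Q < volume R ∧ ∀ z ∈ R, subgrad g z ⊆ Q := by
  obtain ⟨α, h, hh, hhr, hest⟩ := flat_convex_estimate hg hg0 hr hz (ε := r / 8) (by positivity)
  set ε := r / 8 with hε
  have hεpos : 0 < ε := by positivity
  refine ⟨Icc (-(r / 4)) (r / 4) ×ℂ Ioc 0 (h / 2),
    Icc (-(h / 4)) (h / 4) ×ℂ Icc (α - ε) (α + 2 * ε), ?_, ?_, ?_, ?_, ?_⟩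
  · exact (measurableSet_Icc.preimage Complex.measurable_re).inter
      (measurableSet_Ioc.preimage Complex.measurable_im)
  · exact (measurableSet_Icc.preimage Complex.measurable_re).inter
      (measurableSet_Icc.preimage Complex.measurable_im)
  · rintro z ⟨⟨h1, h2⟩, ⟨h3, h4⟩⟩
    rw [mem_ball_zero_iff]
    have := Complex.norm_le_abs_re_add_abs_im z
    have h5 : |z.re| ≤ r / 4 := abs_le.2 ⟨h1, h2⟩
    have h6 : |z.im| ≤ r / 2 := abs_le.2 ⟨by linarith [h3.le], by linarith⟩
    linarith
  · have hvol : ∀ s t : Set ℝ, volume (s ×ℂ t) = volume s * volume t := by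
      intro s t
      rw [← Measure.prod_prod, ← Measure.volume_eq_prod,
        ← Complex.volume_preserving_equiv_real_prod.measure_preimage_equiv]
      rfl
    rw [hvol, hvol, Real.volume_Icc, Real.volume_Icc, Real.volume_Icc, Real.volume_Ioc,
      ← ENNReal.ofReal_mul (by linarith), ← ENNReal.ofReal_mul (by linarith)]
    rw [ENNReal.ofReal_lt_ofReal_iff (by nlinarith)]
    nlinarith
  · rintro z ⟨⟨h1, h2⟩, ⟨h3, h4⟩⟩ p hp
    obtain ⟨s, t⟩ := z
    simp only at h1 h2 h3 h4
    have hs : |s| ≤ r / 2 := abs_le.2 ⟨by linarith, by linarith⟩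
    have e0 := hest s t hs h3 (by linarith)
    have sub : ∀ s' t', g ⟨s, t⟩ + (p.re * (s' - s) + p.im * (t' - t)) ≤ g ⟨s', t'⟩ := by
      intro s' t'
      have := hp ⟨s', t'⟩
      rwa [Complex.real_inner_eq, Complex.sub_re, Complex.sub_im] at this
    have u1 := sub s (2 * t)
    have u2 := sub s (t / 2)
    have u3 := sub (s + r / 4) t
    have u4 := sub (s - r / 4) t
    have e1 := hest s (2 * t) hs (by linarith) (by linarith)
    have e2 := hest s (t / 2) hs (by linarith) (by linarith)
    have e3 := hest (s + r / 4) t (abs_le.2 ⟨by linarith, by linarith⟩) h3 (by linarith)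
    have e4 := hest (s - r / 4) t (abs_le.2 ⟨by linarith, by linarith⟩) h3 (by linarith)
    refine ⟨⟨?_, ?_⟩, ⟨?_, ?_⟩⟩
    · have : -p.re * r ≤ (h / 4) * r := by nlinarith
      nlinarith [le_of_mul_le_mul_right this hr]
    · have : p.re * r ≤ (h / 4) * r := by nlinarith
      nlinarith [le_of_mul_le_mul_right this hr]
    · have : (α - ε) * t ≤ p.im * t := by nlinarith
      exact le_of_mul_le_mul_right this h3
    · have : p.im * t ≤ (α + 2 * ε) * t := by nlinarith
      exact le_of_mul_le_mul_right this h3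

theorem measurePreserving_mul_sub {c : ℂ} (hc : ‖c‖ = 1) (a : ℂ) :
    MeasurePreserving (fun w : ℂ => c * (w - a)) volume volume := by
  have h1 := (rotation ⟨c, mem_sphere_zero_iff_norm.2 hc⟩).measurePreserving
  have h2 := measurePreserving_sub_right (volume : Measure ℂ) a
  exact h1.comp h2

/-- A convex function on the plane whose Monge-Ampère measure dominates Lebesgue measure in `Ω`
is strictly convex there. -/
theorem eq_of_mem_subgrad_of_volume_le {w : ℂ → ℝ} (hw : ConvexOn ℝ univ w) {Ω : Set ℂ}
    (hΩ : IsOpen Ω)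
    (hMA : ∀ R Q : Set ℂ, MeasurableSet R → MeasurableSet Q → R ⊆ Ω →
      (∀ x ∈ R, subgrad w x ⊆ Q) → volume R ≤ volume Q)
    {x x' p : ℂ} (hx : x ∈ Ω) (hp : p ∈ subgrad w x) (hp' : p ∈ subgrad w x') : x = x' := by
  by_contra hne
  set d := ‖x' - x‖ with hd
  have hdpos : 0 < d := norm_pos_iff.2 (sub_ne_zero.2 (Ne.symm hne))
  set e : ℂ := (x' - x) / d with he
  have hde : e * d = x' - x := by
    rw [he, div_mul_cancel₀]; exact_mod_cast hdpos.ne'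
  have henorm : ‖e‖ = 1 := by
    rw [he, norm_div, Complex.norm_real, Real.norm_of_nonneg hdpos.le, ← hd, div_self hdpos.ne']
  have hcc : (starRingEnd ℂ) e * e = 1 := by
    rw [mul_comm, Complex.mul_conj, Complex.normSq_eq_norm_sq, henorm]; norm_num
  have hcnorm : ‖(starRingEnd ℂ) e‖ = 1 := by rw [Complex.norm_conj, henorm]
  obtain ⟨ρ, hρ, hball⟩ := Metric.isOpen_iff.1 hΩ x hx
  set r := min (d / 4) (ρ / 4) with hr
  have hrpos : 0 < r := by positivity
  have hr1 : r ≤ d / 4 := min_le_left _ _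
  have hr2 : r ≤ ρ / 4 := min_le_right _ _
  set x₀ : ℂ := x + e * r with hx₀
  set g : ℂ → ℝ := fun z => w (x₀ + e * z) - w x - ⟪p, x₀ + e * z - x⟫ with hgdef
  have hg : ConvexOn ℝ univ g := by
    refine ⟨convex_univ, fun z _ z' _ a b ha hb hab => ?_⟩
    have h1 := hw.2 (mem_univ (x₀ + e * z)) (mem_univ (x₀ + e * z')) ha hb hab
    have hb' : b = 1 - a := by linarith
    have h2 : a • (x₀ + e * z) + b • (x₀ + e * z') = x₀ + e * (a • z + b • z') := by
      simp only [Complex.real_smul, hb', Complex.ofReal_sub, Complex.ofReal_one]; ring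
    have h3 : x₀ + e * (a • z + b • z') - x = a • (x₀ + e * z - x) + b • (x₀ + e * z' - x) := by
      simp only [Complex.real_smul, hb', Complex.ofReal_sub, Complex.ofReal_one]; ring
    rw [h2] at h1
    simp only [hgdef, smul_eq_mul] at h1 ⊢
    rw [h3, inner_add_right, inner_smul_right, inner_smul_right]
    rw [hb'] at h1 ⊢
    linarith
  have hg0 : ∀ z, 0 ≤ g z := fun z => by have := hp (x₀ + e * z); simp only [hgdef]; linarith
  have hgz : ∀ s : ℝ, |s| ≤ r → g s = 0 := by
    intro s hs
    refine le_antisymm ?_ (hg0 _)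
    obtain ⟨hs1, hs2⟩ := abs_le.1 hs
    set l := (r + s) / d with hl
    have hld : l * d = r + s := by rw [hl]; field_simp
    have hl0 : 0 ≤ l := div_nonneg (by linarith) hdpos.le
    have hl1 : l ≤ 1 := by rw [hl, div_le_one hdpos]; linarith
    have hld' : (l : ℂ) * d = r + s := by exact_mod_cast hld
    have hpt : x₀ + e * s = (1 - l) • x + l • x' := by
      have : x' = x + e * d := by rw [hde]; ring
      rw [this, hx₀, Complex.real_smul, Complex.real_smul, Complex.ofReal_sub, Complex.ofReal_one]
      linear_combination -e * hld'
    have hpt' : x₀ + e * s - x = l • (x' - x) := by rw [hpt]; module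
    have h1 := hw.2 (mem_univ x) (mem_univ x') (sub_nonneg.2 hl1) hl0 (by ring)
    have h2 := hp' x
    have h3 : ⟪p, x - x'⟫ = -⟪p, x' - x⟫ := by rw [← inner_neg_right, neg_sub]
    simp only [hgdef]
    rw [hpt', inner_smul_right, hpt]
    simp only [smul_eq_mul] at h1
    nlinarith
  obtain ⟨R, Q, hR, hQ, hRb, hlt, hsub⟩ := exists_subgrad_image_small hg hg0 hrpos hgz
  have hmR := measurePreserving_mul_sub hcnorm x₀
  have hmQ := measurePreserving_mul_sub hcnorm p
  have hle := hMA ((fun y => (starRingEnd ℂ) e * (y - x₀)) ⁻¹' R)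
    ((fun y => (starRingEnd ℂ) e * (y - p)) ⁻¹' Q) (hmR.measurable hR) (hmQ.measurable hQ) ?_ ?_
  · rw [hmR.measure_preimage hR.nullMeasurableSet, hmQ.measure_preimage hQ.nullMeasurableSet] at hle
    exact absurd hlt hle.not_gt
  · intro y hy
    apply hball
    have h1 := hRb hy
    rw [mem_ball_zero_iff, norm_mul, hcnorm, one_mul] at h1
    have h2 : y - x = (y - x₀) + e * r := by rw [hx₀]; ring
    have h3 : ‖e * (r : ℂ)‖ = r := by
      rw [norm_mul, henorm, one_mul, Complex.norm_real, Real.norm_of_nonneg hrpos.le]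
    rw [mem_ball, dist_eq_norm, h2]
    have := norm_add_le (y - x₀) (e * r)
    linarith
  · intro y hy q hq
    refine hsub _ hy ?_
    intro z
    have h1 : x₀ + e * ((starRingEnd ℂ) e * (y - x₀)) = y := by
      linear_combination (y - x₀) * hcc
    have h2 := hq (x₀ + e * z)
    simp only [hgdef]
    rw [h1]
    have h3 : ⟪(starRingEnd ℂ) e * (q - p), z - (starRingEnd ℂ) e * (y - x₀)⟫
        = ⟪q - p, x₀ + e * z - y⟫ := by
      have : x₀ + e * z - y = e * (z - (starRingEnd ℂ) e * (y - x₀)) := by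
        linear_combination (y - x₀) * hcc
      rw [this, Complex.inner, Complex.inner]
      simp only [map_mul, Complex.conj_conj]
      congr 1; ring
    rw [h3, inner_sub_left]
    have h4 : ⟪p, x₀ + e * z - x⟫ = ⟪p, x₀ + e * z - y⟫ + ⟪p, y - x⟫ := by
      rw [← inner_add_right]; congr 1; ring
    linarith

end StrictConvexity

section AreaFormula

theorem Complex.det_continuousLinearMap (A : ℂ →L[ℝ] ℂ) :
    A.det = (A 1).re * (A Complex.I).im - (A Complex.I).re * (A 1).im := by
  rw [ContinuousLinearMap.det, ← LinearMap.det_toMatrix Complex.basisOneI, Matrix.det_fin_two]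
  simp [LinearMap.toMatrix_apply]

theorem inner_fderiv_nonneg_of_monotone {T : ℂ → ℂ} (hmono : ∀ y z, 0 ≤ ⟪T y - T z, y - z⟫) {y : ℂ}
    (hd : DifferentiableAt ℝ T y) (v : ℂ) : 0 ≤ ⟪fderiv ℝ T y v, v⟫ := by
  have hm : Monotone fun t : ℝ => ⟪T (y + t • v), v⟫ := by
    intro s t hst
    rcases hst.eq_or_lt with rfl | hlt
    · rfl
    have h1 := hmono (y + t • v) (y + s • v)
    have h2 : y + t • v - (y + s • v) = (t - s) • v := by module
    rw [h2, inner_smul_right, inner_sub_left] at h1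
    have := nonneg_of_mul_nonneg_right h1 (sub_pos.2 hlt)
    simp only
    linarith
  have h1 : HasDerivAt (fun t : ℝ => y + t • v) v 0 := by
    simpa using ((hasDerivAt_id (0 : ℝ)).smul_const v).const_add y
  have h2 : HasFDerivAt T (fderiv ℝ T y) (y + (0 : ℝ) • v) := by
    simpa using hd.hasFDerivAt
  have h3 := (h2.comp_hasDerivAt (0 : ℝ) h1).inner ℝ (hasDerivAt_const (0 : ℝ) v)
  have h4 := hm.deriv_nonneg (x := (0 : ℝ))
  have h5 := h3.deriv
  simp only [Function.comp_def, inner_zero_right, zero_add] at h5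
  rwa [h5] at h4

theorem Complex.det_nonneg_and_trace_nonneg {A : ℂ →L[ℝ] ℂ} (hA : ∀ v, 0 ≤ ⟪A v, v⟫) :
    0 ≤ A.det ∧ 0 ≤ (A 1).re + (A Complex.I).im := by
  have key : ∀ s t : ℝ, 0 ≤ (A 1).re * s ^ 2 + ((A 1).im + (A Complex.I).re) * s * t
      + (A Complex.I).im * t ^ 2 := by
    intro s t
    have h := hA (s • (1 : ℂ) + t • Complex.I)
    rw [map_add, map_smul, map_smul, Complex.real_inner_eq] at h
    simp only [Complex.add_re, Complex.add_im, Complex.smul_re, Complex.smul_im, Complex.one_re,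
      Complex.one_im, Complex.I_re, Complex.I_im, smul_eq_mul] at h
    linarith
  have h1 := discrim_le_zero (a := (A 1).re) (b := (A 1).im + (A Complex.I).re)
    (c := (A Complex.I).im) fun x => by have := key x 1; linarith
  rw [discrim] at h1
  have h2 := key 1 0
  have h3 := key 0 1
  rw [Complex.det_continuousLinearMap]
  exact ⟨by nlinarith [sq_nonneg ((A 1).im - (A Complex.I).re)], by linarith⟩

theorem lintegral_det_fderiv_eq_volume_image {T : ℂ → ℂ} (hmono : ∀ y z, 0 ≤ ⟪T y - T z, y - z⟫)
    {K : Set ℂ} (hK : IsCompact K) (hd : ∀ y ∈ K, DifferentiableAt ℝ T y) :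
    ∫⁻ y in K, ENNReal.ofReal (fderiv ℝ T y).det = volume (T '' K) := by
  have hdet : ∀ y ∈ K, 0 ≤ (fderiv ℝ T y).det ∧
      0 ≤ (fderiv ℝ T y 1).re + (fderiv ℝ T y Complex.I).im := fun y hy =>
    Complex.det_nonneg_and_trace_nonneg fun v => inner_fderiv_nonneg_of_monotone hmono (hd y hy) v
  apply le_antisymm
  · obtain ⟨R, hRpos, hR⟩ := hK.isBounded.exists_pos_norm_le
    have hcont : ContinuousOn T K := fun y hy => (hd y hy).continuousAt.continuousWithinAt
    have hTK := hK.image_of_continuousOn hcont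
    have hlim : Filter.Tendsto (fun δ : ℝ => volume (cthickening (δ * R) (T '' K)))
        (nhdsWithin 0 (Ioi 0)) (nhds (volume (T '' K))) := by
      refine (tendsto_measure_cthickening_of_isCompact hTK).comp ?_
      have : Filter.Tendsto (fun δ : ℝ => δ * R) (nhds 0) (nhds (0 * R)) :=
        (continuous_id.mul continuous_const).tendsto 0
      rw [zero_mul] at this
      exact this.mono_left nhdsWithin_le_nhds
    refine ge_of_tendsto hlim ?_
    filter_upwards [self_mem_nhdsWithin] with δ hδ
    have hδ : 0 < δ := hδ
    set S : ℂ → ℂ := fun y => T y + δ • y with hS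
    have hder : ∀ y ∈ K, HasFDerivWithinAt S
        (fderiv ℝ T y + δ • ContinuousLinearMap.id ℝ ℂ) K y := fun y hy =>
      ((hd y hy).hasFDerivAt.add ((hasFDerivAt_id y).const_smul δ)).hasFDerivWithinAt
    have hinj : InjOn S K := by
      intro y _ z _ hyz
      have h1 : T y - T z = -(δ • (y - z)) := by
        have : T y + δ • y = T z + δ • z := hyz
        rw [smul_sub]
        linear_combination this
      have h2 := hmono y z
      rw [h1, inner_neg_left, real_inner_smul_left, real_inner_self_eq_norm_sq] at h2
      have h3 : ‖y - z‖ ^ 2 ≤ 0 := by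
        by_contra! h
        nlinarith [mul_pos hδ h]
      have h4 : ‖y - z‖ = 0 := by nlinarith [norm_nonneg (y - z)]
      exact sub_eq_zero.1 (norm_eq_zero.1 h4)
    have harea := lintegral_abs_det_fderiv_eq_addHaar_image volume hK.measurableSet hder hinj
    calc ∫⁻ y in K, ENNReal.ofReal (fderiv ℝ T y).det
        ≤ ∫⁻ y in K, ENNReal.ofReal |(fderiv ℝ T y + δ • ContinuousLinearMap.id ℝ ℂ).det| := by
          refine setLIntegral_mono' hK.measurableSet fun y hy => ENNReal.ofReal_le_ofReal ?_
          refine le_trans ?_ (le_abs_self _)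
          obtain ⟨-, h2⟩ := hdet y hy
          simp only [Complex.det_continuousLinearMap, _root_.add_apply, _root_.smul_apply,
            ContinuousLinearMap.id_apply, Complex.add_re, Complex.add_im, Complex.smul_re,
            Complex.smul_im, Complex.one_re, Complex.one_im, Complex.I_re, Complex.I_im,
            smul_eq_mul]
          nlinarith [mul_nonneg hδ.le h2, sq_nonneg δ]
      _ = volume (S '' K) := harea
      _ ≤ volume (cthickening (δ * R) (T '' K)) := by
          apply measure_mono
          rintro _ ⟨y, hy, rfl⟩
          refine mem_cthickening_of_dist_le _ (T y) _ _ (mem_image_of_mem T hy) ?_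
          rw [dist_eq_norm, hS, add_sub_cancel_left, norm_smul, Real.norm_of_nonneg hδ.le]
          exact mul_le_mul_of_nonneg_left (hR y hy) hδ.le
  · refine (addHaar_image_le_lintegral_abs_det_fderiv volume hK.measurableSet fun y hy =>
      (hd y hy).hasFDerivAt.hasFDerivWithinAt).trans ?_
    refine (setLIntegral_congr_fun hK.measurableSet fun y hy => ?_).le
    rw [abs_of_nonneg (hdet y hy).1]

theorem ae_le_of_forall_compact_lintegral_le {f g : ℂ → ℝ≥0∞} (hf : Measurable f)
    (hg : Measurable g) {W : Set ℂ} (hW : MeasurableSet W)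
    (h : ∀ K ⊆ W, IsCompact K → ∫⁻ y in K, g y ≤ ∫⁻ y in K, f y ∧ ∫⁻ y in K, f y ≠ ∞) :
    ∀ᵐ y, y ∈ W → g y ≤ f y := by
  rw [ae_iff]
  by_contra hpos
  have hset : {y | ¬(y ∈ W → g y ≤ f y)} = W ∩ {y | f y < g y} := by
    ext y; simp
  have hmeas : MeasurableSet (W ∩ {y | f y < g y}) := hW.inter (measurableSet_lt hf hg)
  rw [hset] at hpos
  obtain ⟨K, hKW, hK, hKpos⟩ := hmeas.exists_lt_isCompact (pos_iff_ne_zero.2 hpos)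
  obtain ⟨h1, h2⟩ := h K (hKW.trans inter_subset_left) hK
  exact absurd (setLIntegral_strict_mono hK.measurableSet hKpos.ne' hg h2
    (ae_of_all _ fun y hy => (hKW hy).2)) h1.not_gt

end AreaFormula

section Holomorphy

/-- A Lipschitz function that is complex differentiable almost everywhere in an open set is
holomorphic there. -/
theorem LipschitzWith.differentiableOn_of_ae {F : ℂ → ℂ} {C : ℝ≥0} (hF : LipschitzWith C F)
    {U : Set ℂ} (hU : IsOpen U) (h : ∀ᵐ z, z ∈ U → DifferentiableAt ℂ F z) :
    DifferentiableOn ℂ F U := by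
  intro z₀ hz₀
  obtain ⟨ρ, hρ, hball⟩ := Metric.isOpen_iff.1 hU z₀ hz₀
  set ε : ℕ → ℝ := fun n => ρ / 2 / (n + 1) with hε
  have hεpos : ∀ n, 0 < ε n := fun n => by positivity
  have hεle : ∀ n, ε n ≤ ρ / 2 := fun n => div_le_self (by positivity) (by simp)
  set μ : ℕ → Measure ℂ := fun n => ProbabilityTheory.cond volume (ball 0 (ε n)) with hμ
  have hprob : ∀ n, IsProbabilityMeasure (μ n) := fun n =>
    ProbabilityTheory.cond_isProbabilityMeasure_of_finite
      (measure_ball_pos _ _ (hεpos n)).ne' measure_ball_lt_top.ne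
  have hmem : ∀ n, ∀ᵐ v ∂(μ n), ‖v‖ < ε n := fun n => by
    filter_upwards [ProbabilityTheory.ae_cond_mem measurableSet_ball] with v hv
    exact mem_ball_zero_iff.1 hv
  have hasm : ∀ n z, AEStronglyMeasurable (fun v => F (z + v)) (μ n) := fun n z =>
    (hF.continuous.comp (continuous_const.add continuous_id)).aestronglyMeasurable
  have hdist : ∀ n z, ∀ᵐ v ∂(μ n), ‖F (z + v) - F z‖ ≤ C * ε n := fun n z => by
    filter_upwards [hmem n] with v hv
    have := hF.dist_le_mul (z + v) z
    rw [dist_eq_norm, dist_eq_norm, add_sub_cancel_left] at this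
    exact this.trans (mul_le_mul_of_nonneg_left hv.le C.2)
  have hint : ∀ n z, Integrable (fun v => F (z + v)) (μ n) := fun n z => by
    have h1 := Integrable.of_bound ((hasm n z).sub aestronglyMeasurable_const) _ (hdist n z)
    simpa using h1.add (integrable_const (F z))
  have hdiff : ∀ n, DifferentiableOn ℂ (fun z => ∫ v, F (z + v) ∂(μ n)) (ball z₀ (ρ / 2)) := by
    intro n z hz
    have hder : ∀ᵐ v ∂(μ n), HasDerivAt (fun x => F (x + v)) (deriv F (z + v)) z := by
      have h1 := (measurePreserving_add_left (volume : Measure ℂ) z).quasiMeasurePreserving.ae h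
      have h2 : ∀ᵐ v ∂(μ n), z + v ∈ U → DifferentiableAt ℂ F (z + v) :=
        ProbabilityTheory.cond_absolutelyContinuous.ae_le h1
      filter_upwards [h2, hmem n] with v hv hvn
      refine HasDerivAt.comp_add_const z v (hv (hball ?_)).hasDerivAt
      rw [mem_ball] at hz ⊢
      calc dist (z + v) z₀ ≤ dist (z + v) z + dist z z₀ := dist_triangle _ _ _
        _ < ρ / 2 + ρ / 2 := by
            rw [dist_self_add_left]
            exact add_lt_add (hvn.trans_le (hεle n)) hz
        _ = ρ := add_halves ρ
    exact (hasDerivAt_integral_of_dominated_loc_of_lip (bound := fun _ => (C : ℝ))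
      (F := fun z v => F (z + v)) (s := univ) Filter.univ_mem
      (Filter.Eventually.of_forall fun x => hasm n x) (hint n z)
      ((measurable_deriv F).comp (measurable_const_add z)).aestronglyMeasurable
      (ae_of_all _ fun v => by
        refine (LipschitzWith.of_dist_le_mul fun x y => ?_).lipschitzOnWith
        have := hF.dist_le_mul (x + v) (y + v)
        simpa [dist_add_right] using this)
      (integrable_const _) hder).2.differentiableAt.differentiableWithinAt
  have hunif : TendstoUniformlyOn (fun n z => ∫ v, F (z + v) ∂(μ n)) F Filter.atTop
      (ball z₀ (ρ / 2)) := by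
    rw [Metric.tendstoUniformlyOn_iff]
    intro η hη
    have hlim : Filter.Tendsto (fun n => C * ε n) Filter.atTop (nhds 0) := by
      have h1 := (tendsto_one_div_add_atTop_nhds_zero_nat (𝕜 := ℝ)).const_mul (C * (ρ / 2))
      rw [mul_zero] at h1
      refine h1.congr fun n => ?_
      simp only [hε]
      ring
    filter_upwards [hlim.eventually (gt_mem_nhds hη)] with n hn z _
    rw [dist_comm, dist_eq_norm]
    have h1 : ∫ v, F (z + v) ∂(μ n) - F z = ∫ v, (F (z + v) - F z) ∂(μ n) := by
      rw [integral_sub (hint n z) (integrable_const _)]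
      simp
    have h2 := norm_integral_le_of_norm_le_const (hdist n z)
    rw [probReal_univ, mul_one] at h2
    rw [h1]
    exact h2.trans_lt hn
  exact ((hunif.tendstoLocallyUniformlyOn.differentiableOn
    (Filter.Eventually.of_forall hdiff) isOpen_ball).differentiableAt
      (ball_mem_nhds _ (by positivity))).differentiableWithinAt

end Holomorphy

section Transport

/-- `w` is a convex potential on the plane whose gradient transports Lebesgue measure on the open
set `Ω` to Lebesgue measure on the open set `Ωs`. -/
structure IsTransportPotential (w : ℂ → ℝ) (Ω Ωs : Set ℂ) : Prop where
  convexOn : ConvexOn ℝ univ w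
  isOpen_source : IsOpen Ω
  isOpen_target : IsOpen Ωs
  ae_singleton : ∀ᵐ x, ∃ p, subgrad w x = {p}
  volume_eq : ∀ E : Set ℂ, MeasurableSet E →
    volume {x ∈ Ω | ∃ p ∈ E, subgrad w x = {p}} = volume (E ∩ Ωs)

namespace IsTransportPotential

variable {w : ℂ → ℝ} {Ω Ωs : Set ℂ} {T : ℂ → ℂ}

theorem eq_of_mem_subgrad (h : IsTransportPotential w Ω Ωs) {x x' p : ℂ} (hx : x ∈ Ω)
    (hp : p ∈ subgrad w x) (hp' : p ∈ subgrad w x') : x = x' := by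
  refine eq_of_mem_subgrad_of_volume_le h.convexOn h.isOpen_source ?_ hx hp hp'
  intro R Q hR hQ hRΩ hsub
  calc volume R ≤ volume {x ∈ Ω | ∃ p ∈ Q, subgrad w x = {p}} := by
        refine measure_mono_ae ?_
        filter_upwards [h.ae_singleton] with x hx hxR
        obtain ⟨p, hp⟩ := hx
        exact ⟨hRΩ hxR, p, hsub x hxR (hp ▸ mem_singleton p), hp⟩
    _ = volume (Q ∩ Ωs) := h.volume_eq Q hQ
    _ ≤ volume Q := measure_mono inter_subset_left

theorem isOpen_regular (h : IsTransportPotential w Ω Ωs) (hT : IsResolvent w T) :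
    IsOpen {y | T y ∈ Ω ∧ y - T y ∈ Ωs} :=
  (h.isOpen_source.preimage hT.lipschitzWith.continuous).inter
    (h.isOpen_target.preimage hT.lipschitzWith_sub.continuous)

theorem volume_image_eq (h : IsTransportPotential w Ω Ωs) (hT : IsResolvent w T) {K : Set ℂ}
    (hK : IsCompact K) (hKV : K ⊆ {y | T y ∈ Ω ∧ y - T y ∈ Ωs}) :
    volume (T '' K) = volume ((fun y => y - T y) '' K) := by
  have hPK : IsCompact ((fun y => y - T y) '' K) := hK.image hT.lipschitzWith_sub.continuous
  have hsub : (fun y => y - T y) '' K ⊆ Ωs := by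
    rintro _ ⟨y, hy, rfl⟩
    exact (hKV hy).2
  rw [← inter_eq_self_of_subset_left hsub, ← h.volume_eq _ hPK.measurableSet]
  refine measure_congr (Filter.eventuallyEq_set.2 ?_)
  filter_upwards [h.ae_singleton] with x hx
  constructor
  · rintro ⟨y, hy, rfl⟩
    obtain ⟨p, hp⟩ := hx
    have h1 := hT y
    rw [hp, mem_singleton_iff] at h1
    exact ⟨(hKV hy).1, p, ⟨y, hy, h1⟩, hp⟩
  · rintro ⟨hxΩ, _, ⟨y, hy, rfl⟩, hp⟩
    refine ⟨y, hy, (h.eq_of_mem_subgrad hxΩ ?_ (hT y)).symm⟩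
    rw [hp]
    exact mem_singleton _

theorem ae_det_eq (h : IsTransportPotential w Ω Ωs) (hT : IsResolvent w T) :
    ∀ᵐ y, y ∈ {y | T y ∈ Ω ∧ y - T y ∈ Ωs} →
      (fderiv ℝ T y).det = (fderiv ℝ (fun y => y - T y) y).det := by
  set P : ℂ → ℂ := fun y => y - T y with hP
  have hTm := hT.inner_apply_sub_nonneg
  have hPm : ∀ y z, 0 ≤ ⟪P y - P z, y - z⟫ := hT.inner_residual_sub_nonneg
  set W := {y | T y ∈ Ω ∧ y - T y ∈ Ωs} ∩
    ({y | DifferentiableAt ℝ T y} ∩ {y | DifferentiableAt ℝ P y}) with hWdef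
  have hW : MeasurableSet W := (h.isOpen_regular hT).measurableSet.inter
    ((measurableSet_of_differentiableAt ℝ T).inter (measurableSet_of_differentiableAt ℝ P))
  have hmeas : ∀ S : ℂ → ℂ, Measurable fun y => ENNReal.ofReal (fderiv ℝ S y).det := fun S =>
    ((ContinuousLinearMap.continuous_det.measurable).comp (measurable_fderiv ℝ S)).ennreal_ofReal
  have hK : ∀ K ⊆ W, IsCompact K →
      ∫⁻ y in K, ENNReal.ofReal (fderiv ℝ T y).det =
        ∫⁻ y in K, ENNReal.ofReal (fderiv ℝ P y).det ∧
      ∫⁻ y in K, ENNReal.ofReal (fderiv ℝ T y).det ≠ ∞ := by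
    intro K hKW hKc
    rw [lintegral_det_fderiv_eq_volume_image hTm hKc fun y hy => (hKW hy).2.1,
      lintegral_det_fderiv_eq_volume_image hPm hKc fun y hy => (hKW hy).2.2]
    exact ⟨h.volume_image_eq hT hKc (hKW.trans inter_subset_left),
      (hKc.image hT.lipschitzWith.continuous).measure_lt_top.ne⟩
  filter_upwards [hT.lipschitzWith.ae_differentiableAt (μ := volume),
    hT.lipschitzWith_sub.ae_differentiableAt (μ := volume),
    ae_le_of_forall_compact_lintegral_le (hmeas T) (hmeas P) hW fun K hKW hKc =>
      ⟨(hK K hKW hKc).1.ge, (hK K hKW hKc).2⟩,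
    ae_le_of_forall_compact_lintegral_le (hmeas P) (hmeas T) hW fun K hKW hKc =>
      ⟨(hK K hKW hKc).1.le, (hK K hKW hKc).1 ▸ (hK K hKW hKc).2⟩] with y h1 h2 h3 h4 hy
  have hyW : y ∈ W := ⟨hy, h1, h2⟩
  have d1 := (Complex.det_nonneg_and_trace_nonneg
    fun v => inner_fderiv_nonneg_of_monotone hTm h1 v).1
  have d2 := (Complex.det_nonneg_and_trace_nonneg
    fun v => inner_fderiv_nonneg_of_monotone hPm h2 v).1
  exact le_antisymm ((ENNReal.ofReal_le_ofReal_iff d2).1 (h4 hyW))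
    ((ENNReal.ofReal_le_ofReal_iff d1).1 (h3 hyW))

end IsTransportPotential

/-- The conjugate Cayley transform `y ↦ conj (2 T y - y)` of a resolvent `T`. -/
def cayley (T : ℂ → ℂ) (y : ℂ) : ℂ :=
  (starRingEnd ℂ) (T y - (y - T y))

theorem IsResolvent.lipschitzWith_cayley {w : ℂ → ℝ} {T : ℂ → ℂ} (hT : IsResolvent w T) :
    LipschitzWith 1 (cayley T) := by
  refine LipschitzWith.of_dist_le_mul fun y z => ?_
  rw [dist_eq_norm, dist_eq_norm, NNReal.coe_one, one_mul, cayley, cayley, ← map_sub,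
    Complex.norm_conj]
  refine (sq_le_sq₀ (norm_nonneg _) (norm_nonneg _)).1 ?_
  have h := hT.inner_sub_nonneg y z
  have h1 : y - z = ((y - T y) - (z - T z)) + (T y - T z) := by abel
  have h2 : T y - (y - T y) - (T z - (z - T z)) = (T y - T z) - ((y - T y) - (z - T z)) := by abel
  have h3 := real_inner_comm (T y - T z) ((y - T y) - (z - T z))
  rw [h2, h1, norm_sub_sq_real, norm_add_sq_real]
  linarith

namespace IsTransportPotential

variable {w : ℂ → ℝ} {Ω Ωs : Set ℂ} {T : ℂ → ℂ}

theorem differentiableOn_cayley (h : IsTransportPotential w Ω Ωs) (hT : IsResolvent w T) :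
    DifferentiableOn ℂ (cayley T) {y | T y ∈ Ω ∧ y - T y ∈ Ωs} := by
  refine hT.lipschitzWith_cayley.differentiableOn_of_ae (h.isOpen_regular hT) ?_
  filter_upwards [hT.lipschitzWith.ae_differentiableAt (μ := volume), h.ae_det_eq hT] with y hd hdet hy
  have hdet := hdet hy
  have hsymm := hT.inner_fderiv_symm hd 1 Complex.I
  have hTd := hd.hasFDerivAt
  have hPd : HasFDerivAt (fun y => y - T y) (ContinuousLinearMap.id ℝ ℂ - fderiv ℝ T y) y :=
    (hasFDerivAt_id y).sub hTd
  have hF : HasFDerivAt (cayley T) ((Complex.conjCLE : ℂ →L[ℝ] ℂ).comp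
      (fderiv ℝ T y - (ContinuousLinearMap.id ℝ ℂ - fderiv ℝ T y))) y :=
    (Complex.conjCLE : ℂ →L[ℝ] ℂ).hasFDerivAt.comp y (hTd.sub hPd)
  rw [differentiableAt_complex_iff_differentiableAt_real, hF.fderiv]
  refine ⟨hF.differentiableAt, ?_⟩
  rw [hPd.fderiv, Complex.det_continuousLinearMap, Complex.det_continuousLinearMap] at hdet
  rw [Complex.real_inner_eq, Complex.real_inner_eq] at hsymm
  simp only [_root_.sub_apply, ContinuousLinearMap.id_apply, Complex.sub_re, Complex.sub_im,
    Complex.one_re, Complex.one_im, Complex.I_re, Complex.I_im] at hdet hsymm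
  apply Complex.ext <;>
  · simp
    nlinarith

theorem norm_deriv_cayley_lt_one (h : IsTransportPotential w Ω Ωs) (hT : IsResolvent w T) {y : ℂ}
    (hy : y ∈ {y | T y ∈ Ω ∧ y - T y ∈ Ωs}) : ‖deriv (cayley T) y‖ < 1 := by
  set V := {y | T y ∈ Ω ∧ y - T y ∈ Ωs} with hV
  have hVo : IsOpen V := h.isOpen_regular hT
  have hle : ∀ z, ‖deriv (cayley T) z‖ ≤ 1 := fun z => by
    simpa using norm_deriv_le_of_lipschitz (x₀ := z) hT.lipschitzWith_cayley
  refine (hle y).lt_of_ne fun hone => ?_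
  have hdF := h.differentiableOn_cayley hT
  have hev : ∀ᶠ z in nhds y, DifferentiableAt ℂ (deriv (cayley T)) z := by
    filter_upwards [hVo.mem_nhds hy] with z hz
    exact (hdF.deriv hVo).differentiableAt (hVo.mem_nhds hz)
  have hmax : IsLocalMax (norm ∘ deriv (cayley T)) y :=
    Filter.Eventually.of_forall fun z => by
      simp only [Function.comp_apply, hone]
      exact hle z
  have hconst := Complex.eventually_eq_of_isLocalMax_norm hev hmax
  obtain ⟨ρ, hρ, hball⟩ := Metric.eventually_nhds_iff_ball.1 (hconst.and (hVo.eventually_mem hy))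
  set g := deriv (cayley T) y with hg
  have hgg : (starRingEnd ℂ) g * g = 1 := by
    rw [mul_comm, Complex.mul_conj, Complex.normSq_eq_norm_sq, hone]; norm_num
  have hlin : ∀ z ∈ ball y ρ, cayley T z - cayley T y = g * (z - y) := by
    intro z hz
    have hder : ∀ z ∈ ball y ρ,
        HasDerivWithinAt (fun z => cayley T z - g * z) 0 (ball y ρ) z := by
      intro z hz
      obtain ⟨h1, h2⟩ := hball z hz
      have h3 := (hdF.differentiableAt (hVo.mem_nhds h2)).hasDerivAt
      have h4 := h3.sub ((hasDerivAt_id z).const_mul g)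
      rw [h1, mul_one, sub_self] at h4
      exact h4.hasDerivWithinAt
    have h5 := (convex_ball y ρ).norm_image_sub_le_of_norm_hasDerivWithin_le hder
      (C := 0) (fun _ _ => by simp) (mem_ball_self hρ) hz
    rw [zero_mul, norm_le_zero_iff] at h5
    linear_combination h5
  obtain ⟨v, hv0, hv⟩ : ∃ v : ℂ, v ≠ 0 ∧ (starRingEnd ℂ) (g * v) = v := by
    by_cases hg1 : 1 + (starRingEnd ℂ) g = 0
    · refine ⟨Complex.I, Complex.I_ne_zero, ?_⟩
      rw [map_mul, Complex.conj_I]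
      linear_combination -Complex.I * hg1
    · refine ⟨_, hg1, ?_⟩
      rw [map_mul, map_add, map_one, Complex.conj_conj]
      linear_combination hgg
  set t : ℝ := ρ / (2 * ‖v‖) with ht
  have hvn : 0 < ‖v‖ := norm_pos_iff.2 hv0
  have htpos : 0 < t := by positivity
  have hz : y + t • v ∈ ball y ρ := by
    rw [mem_ball, dist_self_add_left, norm_smul, Real.norm_of_nonneg htpos.le, ht]
    have : ρ / (2 * ‖v‖) * ‖v‖ = ρ / 2 := by field_simp
    linarith
  have h1 := hlin _ hz
  rw [add_sub_cancel_left] at h1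
  have h2 := congrArg (starRingEnd ℂ) h1
  have h3 : (starRingEnd ℂ) (g * t • v) = t • v := by
    rw [Complex.real_smul, map_mul, map_mul, Complex.conj_ofReal]
    rw [map_mul] at hv
    linear_combination (t : ℂ) * hv
  rw [h3, cayley, cayley, map_sub, Complex.conj_conj, Complex.conj_conj] at h2
  have h4 : (y + t • v) - T (y + t • v) = y - T y := by linear_combination (-1 / 2 : ℂ) * h2
  have h5 := hT (y + t • v)
  rw [h4] at h5
  have h6 := h.eq_of_mem_subgrad hy.1 (hT y) h5
  rw [← h6] at h4
  have h7 : t • v = 0 := by linear_combination h4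
  rcases smul_eq_zero.1 h7 with h8 | h8
  · exact htpos.ne' h8
  · exact hv0 h8

/-- Near a point of `Ω` having a subgradient in `Ωs`, the potential is smooth and all points have
a subgradient in `Ωs`. -/
theorem contDiffAt_and_eventually (h : IsTransportPotential w Ω Ωs) (hT : IsResolvent w T)
    {x p : ℂ} (hx : x ∈ Ω) (hp : p ∈ subgrad w x) (hps : p ∈ Ωs) :
    ContDiffAt ℝ (⊤ : ℕ∞) w x ∧ ∀ᶠ y in nhds x, y ∈ Ω ∧ (subgrad w y ∩ Ωs).Nonempty := by
  set V := {y | T y ∈ Ω ∧ y - T y ∈ Ωs} with hV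
  have hVo : IsOpen V := h.isOpen_regular hT
  set y := x + p with hy
  have hTy : T y = x := hT.apply_add hp
  have hyV : y ∈ V := ⟨by rw [hTy]; exact hx, by rw [hTy, hy, add_sub_cancel_left]; exact hps⟩
  have hdF := h.differentiableOn_cayley hT
  have hTeq : T = fun z => (1 / 2 : ℝ) • (z + Complex.conjCLE (cayley T z)) := by
    funext z
    rw [Complex.conjCLE_apply, cayley, Complex.conj_conj, Complex.real_smul]
    push_cast
    ring
  have hFsmooth : ContDiffAt ℝ (⊤ : ℕ∞) (cayley T) y :=
    (hdF.analyticAt (hVo.mem_nhds hyV)).contDiffAt.restrict_scalars ℝ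
  have hTsmooth : ContDiffAt ℝ (⊤ : ℕ∞) T y := by
    rw [hTeq]
    exact (contDiffAt_id.add (Complex.conjCLE.contDiff.contDiffAt.comp y hFsmooth)).const_smul (1 / 2 : ℝ)
  set g := deriv (cayley T) y with hg
  have hFder : HasFDerivAt (cayley T) ((ContinuousLinearMap.toSpanSingleton ℂ g).restrictScalars ℝ) y :=
    (hdF.differentiableAt (hVo.mem_nhds hyV)).hasDerivAt.hasFDerivAt.restrictScalars ℝ
  set A : ℂ →L[ℝ] ℂ := (1 / 2 : ℝ) • (ContinuousLinearMap.id ℝ ℂ +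
    (Complex.conjCLE : ℂ →L[ℝ] ℂ).comp
      ((ContinuousLinearMap.toSpanSingleton ℂ g).restrictScalars ℝ)) with hA
  have hTder : HasFDerivAt T A y := by
    rw [hTeq]
    exact ((hasFDerivAt_id y).add
      ((Complex.conjCLE : ℂ →L[ℝ] ℂ).hasFDerivAt.comp y hFder)).const_smul (1 / 2 : ℝ)
  have hinj : Function.Injective (A : ℂ →ₗ[ℝ] ℂ) := by
    rw [← LinearMap.ker_eq_bot, LinearMap.ker_eq_bot']
    intro v hv
    by_contra hv0
    have h1 : (1 / 2 : ℝ) • (v + (starRingEnd ℂ) (v * g)) = 0 := hv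
    have h2 : v = -(starRingEnd ℂ) (v * g) := by
      rcases smul_eq_zero.1 h1 with h3 | h3
      · norm_num at h3
      · exact eq_neg_of_add_eq_zero_left h3
    have h3 : ‖v‖ = ‖v‖ * ‖g‖ := by
      conv_lhs => rw [h2]
      rw [norm_neg, Complex.norm_conj, norm_mul]
    have h4 := h.norm_deriv_cayley_lt_one hT hyV
    nlinarith [norm_pos_iff.2 hv0]
  set A' : ℂ ≃L[ℝ] ℂ := (LinearEquiv.ofInjectiveEndo _ hinj).toContinuousLinearEquiv with hA'
  have hTder' : HasFDerivAt T (A' : ℂ →L[ℝ] ℂ) y := by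
    convert! hTder using 1
  have hn : ((⊤ : ℕ∞) : WithTop ℕ∞) ≠ 0 := by simp
  set S := hTsmooth.localInverse hTder' hn with hS
  have hSsmooth : ContDiffAt ℝ (⊤ : ℕ∞) S x := hTy ▸ hTsmooth.to_localInverse hTder' hn
  have hSx : S x = y := by
    have := hTsmooth.localInverse_apply_image hTder' hn
    rwa [hTy] at this
  have hTS : ∀ᶠ z in nhds x, T (S z) = z := by
    have := (hTsmooth.hasStrictFDerivAt' hTder' hn).eventually_right_inverse
    rwa [hTy] at this
  have hSV : ∀ᶠ z in nhds x, S z ∈ V :=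
    hSsmooth.continuousAt.eventually (hSx ▸ hVo.mem_nhds hyV)
  have hsel : ∀ᶠ z in nhds x, S z - z ∈ subgrad w z := by
    filter_upwards [hTS] with z hz
    have := hT (S z)
    rwa [hz] at this
  have hcont : ∀ᶠ z in nhds x, ContinuousAt S z := by
    have h1 : ContDiffAt ℝ 1 S x := hSsmooth.of_le (by exact_mod_cast le_top)
    filter_upwards [h1.eventually (by simp)] with z hz
    exact hz.continuousAt
  have hder : ∀ᶠ z in nhds x, HasFDerivAt w (innerSL ℝ (S z - z)) z := by
    filter_upwards [hsel.eventually_nhds, hcont] with z hz hzc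
    exact hasFDerivAt_of_subgrad_selection (q := fun z => S z - z)
      (hzc.sub continuousAt_id) hz
  refine ⟨?_, ?_⟩
  · rw [contDiffAt_infty]
    intro n
    have h1 : ContDiffAt ℝ (n + 1) w x := by
      rw [contDiffAt_succ_iff_hasFDerivAt]
      refine ⟨fun z => innerSL ℝ (S z - z), ⟨_, hder, fun _ hz => hz⟩, ?_⟩
      have h2 : ContDiffAt ℝ (⊤ : ℕ∞) (fun z => S z - z) x := hSsmooth.sub contDiffAt_id
      exact ((innerSL ℝ (E := ℂ)).contDiff.contDiffAt.comp x h2).of_le (by exact_mod_cast le_top)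
    exact h1.of_le le_self_add
  · filter_upwards [hTS, hSV, hsel] with z h1 h2 h3
    rw [hV, mem_ofPred_eq, h1] at h2
    exact ⟨h2.1, _, h3, h2.2⟩

end IsTransportPotential

end Transport

section Gradient

variable {E : Type*} [NormedAddCommGroup E] [InnerProductSpace ℝ E] [CompleteSpace E]

theorem gradient_mem_subgrad {u : E → ℝ} (hu : ConvexOn ℝ univ u) {x : E}
    (hd : DifferentiableAt ℝ u x) : gradient u x ∈ subgrad u x := by
  intro z
  have hconv : ConvexOn ℝ univ (u ∘ AffineMap.lineMap x z : ℝ → ℝ) :=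
    hu.comp_affineMap (AffineMap.lineMap x z)
  have hline : HasDerivAt (AffineMap.lineMap x z : ℝ → E) (z - x) 0 := AffineMap.hasDerivAt_lineMap
  have hu' : HasFDerivAt u (innerSL ℝ (gradient u x)) ((AffineMap.lineMap x z : ℝ → E) 0) := by
    rw [AffineMap.lineMap_apply_zero]
    exact hd.hasGradientAt.hasFDerivAt
  have h := hconv.le_slope_of_hasDerivAt (mem_univ 0) (mem_univ 1) zero_lt_one
    (hu'.comp_hasDerivAt 0 hline)
  rw [slope_def_field, innerSL_apply_apply] at h
  simp only [Function.comp_apply, AffineMap.lineMap_apply_one, AffineMap.lineMap_apply_zero,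
    sub_zero, div_one] at h
  linarith

theorem eq_gradient_of_mem_subgrad {u : E → ℝ} {x p : E} (hd : DifferentiableAt ℝ u x)
    (hp : p ∈ subgrad u x) : p = gradient u x := by
  have hmin : IsLocalMin (fun y => u y - innerSL ℝ p y) x := Filter.Eventually.of_forall fun y => by
    have h := hp y
    rw [inner_sub_right] at h
    simp only [innerSL_apply_apply]
    linarith
  have hder : HasFDerivAt (fun y => u y - innerSL ℝ p y)
      (innerSL ℝ (gradient u x) - innerSL ℝ p) x :=
    hd.hasGradientAt.hasFDerivAt.sub (innerSL ℝ p).hasFDerivAt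
  have h0 := hmin.hasFDerivAt_eq_zero hder
  refine (ext_inner_right ℝ fun v => ?_).symm
  have h1 := congrArg (fun L : E →L[ℝ] ℝ => L v) h0
  simpa [sub_eq_zero] using h1

theorem subgrad_eq_singleton {u : E → ℝ} (hu : ConvexOn ℝ univ u) {x : E}
    (hd : DifferentiableAt ℝ u x) : subgrad u x = {gradient u x} :=
  eq_singleton_iff_unique_mem.2 ⟨gradient_mem_subgrad hu hd, fun _ hp =>
    eq_gradient_of_mem_subgrad hd hp⟩

end Gradient

section Transfer

theorem mem_subgrad_comp_iff {E F : Type*} [NormedAddCommGroup E] [InnerProductSpace ℝ E]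
    [NormedAddCommGroup F] [InnerProductSpace ℝ F] (ι : E ≃ₗᵢ[ℝ] F) {u : F → ℝ} {x p : E} :
    p ∈ subgrad (u ∘ ι) x ↔ ι p ∈ subgrad u (ι x) := by
  refine ⟨fun h z => ?_, fun h z => ?_⟩
  · have := h (ι.symm z)
    rw [← ι.inner_map_map] at this
    simpa using this
  · have := h (ι z)
    rwa [← map_sub, ι.inner_map_map] at this

theorem isTransportPotential_comp (ι : ℂ ≃ₗᵢ[ℝ] E2) {u : E2 → ℝ} {Ω Ωs : Set E2}
    (hu : ConvexOn ℝ univ u) (hΩ : IsOpen Ω) (hΩs : IsOpen Ωs)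
    (hae : ∀ᵐ x : E2, DifferentiableAt ℝ u x)
    (hpush : ∀ E : Set E2, MeasurableSet E →
      volume {x ∈ Ω | DifferentiableAt ℝ u x ∧ gradient u x ∈ E} = volume (E ∩ Ωs)) :
    IsTransportPotential (u ∘ ι) (ι ⁻¹' Ω) (ι ⁻¹' Ωs) := by
  have hae' : ∀ᵐ x : ℂ, DifferentiableAt ℝ u (ι x) :=
    ι.measurePreserving.quasiMeasurePreserving.ae hae
  have hsingle : ∀ x : ℂ, DifferentiableAt ℝ u (ι x) →
      subgrad (u ∘ ι) x = {ι.symm (gradient u (ι x))} := by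
    intro x hx
    ext p
    rw [mem_subgrad_comp_iff, subgrad_eq_singleton hu hx, mem_singleton_iff, mem_singleton_iff,
      ← ι.eq_symm_apply]
  have hvol : ∀ S : Set E2, volume (ι ⁻¹' S) = volume S := fun S =>
    ι.measurePreserving.measure_preimage_emb ι.toHomeomorph.measurableEmbedding S
  refine ⟨?_, hΩ.preimage ι.continuous, hΩs.preimage ι.continuous, ?_, ?_⟩
  · exact hu.comp_linearMap ι.toLinearEquiv.toLinearMap
  · filter_upwards [hae'] with x hx
    exact ⟨_, hsingle x hx⟩
  · intro E hE
    have h1 := hpush (ι.symm ⁻¹' E) (ι.symm.continuous.measurable hE)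
    rw [← hvol, ← hvol (_ ∩ _)] at h1
    have h2 : ι ⁻¹' (ι.symm ⁻¹' E ∩ Ωs) = E ∩ ι ⁻¹' Ωs := by
      ext x
      simp
    rw [h2] at h1
    rw [← h1]
    refine measure_congr (Filter.eventuallyEq_set.2 ?_)
    filter_upwards [hae'] with x hx
    constructor
    · rintro ⟨hxΩ, p, hpE, hp⟩
      rw [hsingle x hx, singleton_eq_singleton_iff] at hp
      exact ⟨hxΩ, hx, by rwa [mem_preimage, hp]⟩
    · rintro ⟨hxΩ, -, hg⟩
      exact ⟨hxΩ, _, hg, hsingle x hx⟩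

/-- A subgradient at an interior point of a segment on which the function is affine is a
subgradient at every point of the segment. -/
theorem mem_subgrad_of_affine_on_segment {E : Type*} [NormedAddCommGroup E]
    [InnerProductSpace ℝ E] {u : E → ℝ} {a b z q p : E} {c : ℝ}
    (hz : z ∈ openSegment ℝ a b) (hq : q ∈ subgrad u z)
    (haff : ∀ y ∈ segment ℝ a b, u y = ⟪p, y⟫ + c) : q ∈ subgrad u a := by
  have hzs := haff z (openSegment_subset_segment ℝ a b hz)
  have ha := haff a (left_mem_segment ℝ a b)
  have hb := haff b (right_mem_segment ℝ a b)
  obtain ⟨s, t, hs, ht, hst, rfl⟩ := hz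
  set z := s • a + t • b with hzdef
  have e1 : z - a = t • (b - a) := by
    rw [hzdef, eq_sub_of_add_eq hst]
    module
  have e2 : b - z = s • (b - a) := by
    rw [hzdef, eq_sub_of_add_eq' hst]
    module
  have h1 := hq b
  have h2 : u b - u z = s * ⟪p, b - a⟫ := by
    rw [hb, hzs, ← real_inner_smul_right, ← e2, inner_sub_right]; ring
  have h3 : u z - u a = t * ⟪p, b - a⟫ := by
    rw [ha, hzs, ← real_inner_smul_right, ← e1, inner_sub_right]; ring
  rw [e2, real_inner_smul_right] at h1
  have h4 : ⟪q, b - a⟫ ≤ ⟪p, b - a⟫ := by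
    refine le_of_mul_le_mul_left ?_ hs
    linarith
  intro y
  have h5 := hq y
  have h6 : ⟪q, y - z⟫ = ⟪q, y - a⟫ - t * ⟪q, b - a⟫ := by
    rw [← real_inner_smul_right, ← e1, ← inner_sub_right]
    congr 1
    abel
  have h7 := mul_le_mul_of_nonneg_left h4 ht.le
  linarith

end Transfer

/-- The set `Ω' = {x ∈ Ω : ∂⁻u(x) ∩ Ω* ≠ ∅}` is open, has full measure in
`Ω`, and `u` is smooth and strictly convex in `Ω'`; consequently `A ⊆ Ω \ Ω'`. -/
theorem regular_set_open_full_measure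
    (Ω Ωs : Set E2)
    (hΩo : IsOpen Ω) (hΩb : Bornology.IsBounded Ω) (hΩc : IsConnected Ω)
    (hΩso : IsOpen Ωs) (hΩsb : Bornology.IsBounded Ωs) (hΩsc : IsConnected Ωs)
    (hΩsnc : ¬ Convex ℝ Ωs)
    (m : ℕ) [NeZero m] (b : Fin m → E2) (hbinj : Function.Injective b)
    (hpoly : frontier Ωs = ⋃ i : Fin m, segment ℝ (b i) (b (i + 1)))
    (hvol : volume Ω = volume Ωs)
    (u : E2 → ℝ) (hconv : ConvexOn ℝ Set.univ u)
    (K : ℝ≥0) (hLip : LipschitzWith K u)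
    (hae : ∀ᵐ x : E2, DifferentiableAt ℝ u x ∧ gradient u x ∈ closure Ωs)
    (hpush : ∀ E : Set E2, MeasurableSet E →
      volume {x ∈ Ω | DifferentiableAt ℝ u x ∧ gradient u x ∈ E} = volume (E ∩ Ωs))
    (A : Set E2) (hA : A = {x ∈ Ω | ¬ DifferentiableAt ℝ u x})
    (Ω' : Set E2) (hΩ' : Ω' = {x ∈ Ω | (subdiff u x ∩ Ωs).Nonempty}) :
    IsOpen Ω' ∧ volume (Ω \ Ω') = 0 ∧ ContDiffOn ℝ (⊤ : ℕ∞) u Ω' ∧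
    (¬ ∃ a b' : E2, a ≠ b' ∧ (segment ℝ a b' ∩ Ω').Nonempty ∧
      ∃ (p : E2) (c : ℝ), ∀ z ∈ segment ℝ a b', u z = ⟪p, z⟫ + c) ∧
    A ⊆ Ω \ Ω' := by
  set ι : ℂ ≃ₗᵢ[ℝ] E2 := Complex.orthonormalBasisOneI.repr
  have hw : IsTransportPotential (u ∘ ι) (ι ⁻¹' Ω) (ι ⁻¹' Ωs) :=
    isTransportPotential_comp ι hconv hΩo hΩso (hae.mono fun _ h => h.1) hpush
  obtain ⟨T, hT⟩ := exists_isResolvent hw.convexOn (hLip.comp ι.lipschitz)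
  have hsub : ∀ {x p : E2}, p ∈ subdiff u x ↔ ι.symm p ∈ subgrad (u ∘ ι) (ι.symm x) := by
    intro x p
    rw [mem_subgrad_comp_iff, ι.apply_symm_apply, ι.apply_symm_apply]
    rfl
  have hreg : ∀ x ∈ Ω', ContDiffAt ℝ (⊤ : ℕ∞) u x ∧ ∀ᶠ y in nhds x, y ∈ Ω' := by
    subst hΩ'
    rintro x ⟨hx, p, hp, hps⟩
    obtain ⟨h1, h2⟩ := hw.contDiffAt_and_eventually hT (x := ι.symm x) (p := ι.symm p)
      (by simpa using hx) (hsub.1 hp) (by simpa using hps)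
    constructor
    · have h3 := h1.comp x ι.symm.contDiff.contDiffAt
      rwa [Function.comp_assoc, ι.self_comp_symm, Function.comp_id] at h3
    · filter_upwards [ι.symm.continuous.continuousAt.eventually h2] with y hy
      obtain ⟨hyΩ, q, hq, hqs⟩ := hy
      exact ⟨by simpa using hyΩ, ι q, hsub.2 (by simpa using hq), hqs⟩
  have hopen : IsOpen Ω' := isOpen_iff_eventually.2 fun x hx => (hreg x hx).2
  refine ⟨hopen, ?_, fun x hx => (hreg x hx).1.contDiffWithinAt, ?_, ?_⟩
  · have h0 := hpush Ωsᶜ hΩso.measurableSet.compl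
    rw [compl_inter_self, measure_empty] at h0
    refine measure_mono_null_ae ?_ h0
    filter_upwards [hae] with x hx hxΩ
    refine ⟨hxΩ.1, hx.1, fun hg => hxΩ.2 ?_⟩
    rw [hΩ']
    exact ⟨hxΩ.1, _, gradient_mem_subgrad hconv hx.1, hg⟩
  · rintro ⟨a, b', hab, ⟨z, hz, hzΩ⟩, p, c, haff⟩
    have hz' : z ∈ closure (openSegment ℝ a b') := by
      rwa [closure_openSegment]
    obtain ⟨y, hyΩ, hy⟩ := mem_closure_iff.1 hz' Ω' hopen hzΩ
    rw [hΩ'] at hyΩ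
    obtain ⟨hyΩ, q, hq, -⟩ := hyΩ
    have hqa : q ∈ subdiff u a := mem_subgrad_of_affine_on_segment hy hq haff
    have hya : ι.symm y = ι.symm a :=
      hw.eq_of_mem_subgrad (by simpa using hyΩ) (hsub.1 hq) (hsub.1 hqa)
    rw [ι.symm.injective hya, left_mem_openSegment_iff] at hy
    exact hab hy
  · subst hA
    rintro x ⟨hx, hnd⟩
    exact ⟨hx, fun hx' => hnd ((hreg x hx').1.differentiableAt (by simp))⟩
end
end

section
/- For every x ∈ Ω with ∂⁻u(x) ∩ Ω* = ∅, the set ∂⁻u(x) is a closed convex polygon: its extreme points lie on ∂Ω*, and ∂⁻u(x) is the convex hull of a finite subset of ∂Ω* (possibly a one-dimensional segment or a single point). -/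
open MeasureTheory Metric Set
open scoped NNReal ENNReal RealInnerProductSpace

noncomputable section

/-- The gradient of a convex function is a subgradient. -/
lemma gradient_mem_subdiff {u : E2 → ℝ} (hconv : ConvexOn ℝ Set.univ u) {y : E2}
    (hd : DifferentiableAt ℝ u y) : gradient u y ∈ subdiff u y := by
  intro z
  have hline : ConvexOn ℝ Set.univ (fun t : ℝ => u (AffineMap.lineMap y z t)) := by
    simpa [Function.comp_def] using hconv.comp_affineMap (AffineMap.lineMap y z : ℝ →ᵃ[ℝ] E2)
  have h0 : HasDerivAt (fun t : ℝ => u (AffineMap.lineMap y z t)) (⟪gradient u y, z - y⟫) 0 := by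
    have h1 : HasFDerivAt u (InnerProductSpace.toDual ℝ E2 (gradient u y))
        (AffineMap.lineMap y z (0 : ℝ)) := by
      simpa using hd.hasGradientAt.hasFDerivAt
    simpa [Function.comp_def] using
      h1.comp_hasDerivAt (0 : ℝ) (AffineMap.hasDerivAt_lineMap (a := y) (b := z))
  have h2 := hline.le_slope_of_hasDerivAt (Set.mem_univ 0) (Set.mem_univ 1) one_pos h0
  simp only [slope_def_field, AffineMap.lineMap_apply_zero, AffineMap.lineMap_apply_one, sub_zero,
    div_one] at h2
  linarith

lemma isClosed_subdiff (u : E2 → ℝ) (x : E2) : IsClosed (subdiff u x) := by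
  simp only [subdiff, Set.ofPred_forall]
  exact isClosed_iInter fun z => isClosed_le (by fun_prop) continuous_const

lemma convex_subdiff (u : E2 → ℝ) (x : E2) : Convex ℝ (subdiff u x) := by
  intro p hp q hq a c ha hc hac z
  have h1 := mul_le_mul_of_nonneg_left (hp z) ha
  have h2 := mul_le_mul_of_nonneg_left (hq z) hc
  rw [inner_add_left, real_inner_smul_left, real_inner_smul_left]
  have : c = 1 - a := by linarith
  subst this
  linarith

/-- In every direction `v`, the support value of the subdifferential is attained at a limit of
gradients, hence at a point of any compact set containing almost every gradient. -/
lemma exists_mem_subdiff_inter_inner_le {u : E2 → ℝ} (hconv : ConvexOn ℝ Set.univ u)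
    (hcont : Continuous u) {F : Set E2} (hF : IsCompact F)
    (hae : ∀ᵐ x : E2, DifferentiableAt ℝ u x ∧ gradient u x ∈ F)
    {x p : E2} (hp : p ∈ subdiff u x) (v : E2) :
    ∃ q ∈ subdiff u x ∩ F, ⟪p, v⟫ ≤ ⟪q, v⟫ := by
  have hdense := Measure.dense_of_ae hae
  have hex (n : ℕ) : ∃ w : E2, (DifferentiableAt ℝ u (x + (1 / ((n : ℝ) + 1)) • w) ∧
      gradient u (x + (1 / ((n : ℝ) + 1)) • w) ∈ F) ∧ dist w v < 1 / ((n : ℝ) + 1) := by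
    have ht : (0 : ℝ) < 1 / ((n : ℝ) + 1) := by positivity
    obtain ⟨y, hy, hyd⟩ := hdense.exists_dist_lt (x + (1 / ((n : ℝ) + 1)) • v) (mul_pos ht ht)
    refine ⟨(1 / ((n : ℝ) + 1))⁻¹ • (y - x), ?_, ?_⟩
    · rwa [smul_inv_smul₀ ht.ne', add_sub_cancel]
    · have h : (1 / ((n : ℝ) + 1))⁻¹ • (y - x) - v =
          (1 / ((n : ℝ) + 1))⁻¹ • (y - (x + (1 / ((n : ℝ) + 1)) • v)) := by
        rw [← sub_sub, smul_sub _ (y - x), inv_smul_smul₀ ht.ne']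
      rw [dist_eq_norm, h, norm_smul, Real.norm_of_nonneg (inv_pos.2 ht).le, ← dist_eq_norm,
        dist_comm, inv_mul_lt_iff₀ ht]
      exact hyd
  choose w hw hwd using hex
  have ht0 := tendsto_one_div_add_atTop_nhds_zero_nat (𝕜 := ℝ)
  have hwv : Filter.Tendsto w Filter.atTop (nhds v) :=
    tendsto_iff_dist_tendsto_zero.2
      (squeeze_zero (fun _ => dist_nonneg) (fun n => (hwd n).le) ht0)
  have hyx : Filter.Tendsto (fun n : ℕ => x + (1 / ((n : ℝ) + 1)) • w n) Filter.atTop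
      (nhds x) := by
    simpa using tendsto_const_nhds.add (ht0.smul hwv)
  obtain ⟨q, hqF, φ, hφ, hq⟩ := hF.tendsto_subseq fun n => (hw n).2
  have hy' := hyx.comp hφ.tendsto_atTop
  refine ⟨q, ⟨fun z => ?_, hqF⟩, ?_⟩
  · refine le_of_tendsto (((hcont.tendsto x).comp hy').add
      (hq.inner (tendsto_const_nhds.sub hy'))) (Filter.Eventually.of_forall fun n => ?_)
    exact gradient_mem_subdiff hconv (hw (φ n)).1 z
  · refine le_of_tendsto_of_tendsto' (tendsto_const_nhds.inner (hwv.comp hφ.tendsto_atTop))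
      (hq.inner (hwv.comp hφ.tendsto_atTop)) fun n => ?_
    have ht : (0 : ℝ) < 1 / ((φ n : ℝ) + 1) := by positivity
    have h1 := gradient_mem_subdiff hconv (hw (φ n)).1 x
    have h2 := hp (x + (1 / ((φ n : ℝ) + 1)) • w (φ n))
    rw [sub_add_cancel_left, inner_neg_right, real_inner_smul_right] at h1
    rw [add_sub_cancel_left, real_inner_smul_right] at h2
    exact le_of_mul_le_mul_left (by simp only [Function.comp_apply]; linarith) ht

/-- In finite dimension, the convex hull of a compact set is compact. -/
lemma isCompact_convexHull_of_isCompact {E : Type*} [NormedAddCommGroup E] [NormedSpace ℝ E]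
    [FiniteDimensional ℝ E] {s : Set E} (hs : IsCompact s) : IsCompact (convexHull ℝ s) := by
  have himage : convexHull ℝ s =
      (fun q : (Fin (Module.finrank ℝ E + 1) → ℝ) × (Fin (Module.finrank ℝ E + 1) → E) =>
        ∑ i, q.1 i • q.2 i) '' (stdSimplex ℝ (Fin (Module.finrank ℝ E + 1)) ×ˢ
          Set.univ.pi fun _ => s) := by
    refine Subset.antisymm (fun x hx => ?_) ?_
    · obtain ⟨ι, _, z, w, hz, hind, hw, hw1, hx⟩ := eq_pos_convex_span_of_mem_convexHull hx
      have hcard : Fintype.card ι ≤ Fintype.card (Fin (Module.finrank ℝ E + 1)) := by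
        rw [Fintype.card_fin]
        exact hind.card_le_finrank_succ.trans (Nat.succ_le_succ (Submodule.finrank_le _))
      obtain ⟨e⟩ := Function.Embedding.nonempty_of_card_le hcard
      have hι : Nonempty ι := by
        by_contra hne
        rw [not_nonempty_iff] at hne
        simp at hw1
      obtain ⟨i₀⟩ := hι
      refine ⟨⟨Function.extend e w 0, Function.extend e z fun _ => z i₀⟩, ⟨⟨fun j => ?_, ?_⟩,
        fun j _ => ?_⟩, ?_⟩
      · by_cases hj : ∃ i, e i = j
        · obtain ⟨i, rfl⟩ := hj
          simpa [e.injective.extend_apply] using (hw i).le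
        · simp [Function.extend_apply' _ _ _ hj]
      · rw [← hw1]
        refine (Fintype.sum_of_injective e e.injective _ _ (fun j hj => ?_) fun i => ?_).symm
        · exact Function.extend_apply' _ _ _ hj
        · exact (e.injective.extend_apply _ _ _).symm
      · by_cases hj : ∃ i, e i = j
        · obtain ⟨i, rfl⟩ := hj
          simpa [e.injective.extend_apply] using hz ⟨i, rfl⟩
        · simpa [Function.extend_apply' _ _ _ hj] using hz ⟨i₀, rfl⟩
      · rw [← hx]
        refine (Fintype.sum_of_injective e e.injective _ _ (fun j hj => ?_) fun i => ?_).symm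
        · simp [Function.extend_apply' _ _ j hj]
        · simp [e.injective.extend_apply]
    · rintro _ ⟨q, ⟨hq, hqs⟩, rfl⟩
      exact (convex_convexHull ℝ s).sum_mem (fun i _ => hq.1 i) hq.2
        fun i _ => subset_convexHull ℝ s (hqs i (Set.mem_univ i))
  rw [himage]
  exact ((isCompact_stdSimplex ℝ _).prod (isCompact_univ_pi fun _ => hs)).image (by fun_prop)

/-- If almost every gradient lies in a compact set `F`, each subdifferential is the convex hull of
its trace on `F`. -/
lemma subdiff_eq_convexHull_inter {u : E2 → ℝ} (hconv : ConvexOn ℝ Set.univ u)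
    (hcont : Continuous u) {F : Set E2} (hF : IsCompact F)
    (hae : ∀ᵐ x : E2, DifferentiableAt ℝ u x ∧ gradient u x ∈ F) (x : E2) :
    subdiff u x = convexHull ℝ (subdiff u x ∩ F) := by
  refine Subset.antisymm (fun p hp => ?_)
    (convexHull_min inter_subset_left (convex_subdiff u x))
  by_contra hpn
  have hR : IsCompact (convexHull ℝ (subdiff u x ∩ F)) :=
    isCompact_convexHull_of_isCompact (hF.inter_left (isClosed_subdiff u x))
  obtain ⟨f, s, hs, hps⟩ := geometric_hahn_banach_closed_point (convex_convexHull ℝ _)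
    hR.isClosed hpn
  obtain ⟨q, hq, hpq⟩ := exists_mem_subdiff_inter_inner_le hconv hcont hF hae hp
    ((InnerProductSpace.toDual ℝ E2).symm f)
  rw [real_inner_comm, InnerProductSpace.toDual_symm_apply, real_inner_comm,
    InnerProductSpace.toDual_symm_apply] at hpq
  linarith [hs q (subset_convexHull ℝ _ hq)]

/-- A line segment contains only finitely many extreme points of a given set. -/
lemma finite_extremePoints_inter_segment {E : Type*} [AddCommGroup E] [Module ℝ E]
    (C : Set E) (a b : E) : (C.extremePoints ℝ ∩ segment ℝ a b).Finite := by
  by_contra hinf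
  rw [segment_eq_image_lineMap] at hinf
  have hT : {t : ℝ | AffineMap.lineMap a b t ∈ C.extremePoints ℝ}.Infinite := by
    refine fun hfin => hinf ((hfin.image (AffineMap.lineMap a b)).subset ?_)
    rintro _ ⟨hy, t, -, rfl⟩
    exact ⟨t, hy, rfl⟩
  by_cases hab : a = b
  · subst hab
    refine hinf ((Set.finite_singleton a).subset ?_)
    rintro _ ⟨-, t, -, rfl⟩
    simp
  obtain ⟨S, hS, hcard⟩ := hT.exists_subset_card_eq 3
  obtain ⟨r, s, t, hr, hs, ht, hrs, hst⟩ : ∃ r s t, r ∈ S ∧ s ∈ S ∧ t ∈ S ∧ r < s ∧ s < t := by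
    refine ⟨S.orderEmbOfFin hcard 0, S.orderEmbOfFin hcard 1, S.orderEmbOfFin hcard 2,
      S.orderEmbOfFin_mem hcard _, S.orderEmbOfFin_mem hcard _, S.orderEmbOfFin_mem hcard _,
      ?_, ?_⟩ <;> simp
  have hmem : AffineMap.lineMap a b s ∈
      openSegment ℝ (AffineMap.lineMap a b r : E) (AffineMap.lineMap a b t) := by
    rw [← image_openSegment, openSegment_eq_Ioo (hrs.trans hst)]
    exact ⟨s, ⟨hrs, hst⟩, rfl⟩
  have heq := (hS hs).2 (hS hr).1 (hS ht).1 hmem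
  exact hrs.ne (AffineMap.lineMap_injective ℝ hab heq)

/-- for `x ∈ Ω` with `∂⁻u(x) ∩ Ω* = ∅`, the set `∂⁻u(x)` is a closed convex
polygon: its extreme points lie on `∂Ω*` and it is the convex hull of a finite subset
of `∂Ω*`. -/
theorem subdifferential_is_polygon
    (Ω Ωs : Set E2)
    (hΩo : IsOpen Ω) (hΩb : Bornology.IsBounded Ω) (hΩc : IsConnected Ω)
    (hΩso : IsOpen Ωs) (hΩsb : Bornology.IsBounded Ωs) (hΩsc : IsConnected Ωs)
    (hΩsnc : ¬ Convex ℝ Ωs)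
    (m : ℕ) [NeZero m] (b : Fin m → E2) (hbinj : Function.Injective b)
    (hpoly : frontier Ωs = ⋃ i : Fin m, segment ℝ (b i) (b (i + 1)))
    (hvol : volume Ω = volume Ωs)
    (u : E2 → ℝ) (hconv : ConvexOn ℝ Set.univ u)
    (K : ℝ≥0) (hLip : LipschitzWith K u)
    (hae : ∀ᵐ x : E2, DifferentiableAt ℝ u x ∧ gradient u x ∈ closure Ωs)
    (hpush : ∀ E : Set E2, MeasurableSet E →
      volume {x ∈ Ω | DifferentiableAt ℝ u x ∧ gradient u x ∈ E} = volume (E ∩ Ωs))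
 :
    ∀ x ∈ Ω, subdiff u x ∩ Ωs = ∅ →
      Set.extremePoints ℝ (subdiff u x) ⊆ frontier Ωs ∧
      ∃ S : Finset E2, ↑S ⊆ frontier Ωs ∧ subdiff u x = convexHull ℝ (↑S : Set E2) := by
  intro x _ hdisj
  have hsub := subdiff_eq_convexHull_inter hconv hLip.continuous hΩsb.isCompact_closure hae x
  have hext : (subdiff u x).extremePoints ℝ ⊆ frontier Ωs := by
    intro p hp
    have hpF : p ∈ subdiff u x ∩ closure Ωs := by
      rw [hsub] at hp
      exact extremePoints_convexHull_subset hp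
    rw [hΩso.frontier_eq]
    exact ⟨hpF.2, fun hpΩ => (hdisj ▸ ⟨hpF.1, hpΩ⟩ : p ∈ (∅ : Set E2))⟩
  have hfin : ((subdiff u x).extremePoints ℝ).Finite := by
    refine (Set.finite_iUnion fun i : Fin m =>
      finite_extremePoints_inter_segment (subdiff u x) (b i) (b (i + 1))).subset ?_
    rw [← inter_iUnion, ← hpoly]
    exact subset_inter Subset.rfl hext
  have hcomp : IsCompact (subdiff u x) := by
    rw [hsub]
    exact isCompact_convexHull_of_isCompact
      (hΩsb.isCompact_closure.inter_left (isClosed_subdiff u x))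
  refine ⟨hext, hfin.toFinset, by simpa using hext, ?_⟩
  rw [hfin.coe_toFinset, ← (hfin.isClosed_convexHull ℝ).closure_eq,
    closure_convexHull_extremePoints hcomp (convex_subdiff u x)]
end
end

section
/- The set Σ_1 := {x ∈ A : b_i ∈ ∂⁻u(x) for some i ∈ {1,…,m}} is finite, with cardinality at most m. -/
open MeasureTheory Metric Set
open scoped NNReal ENNReal RealInnerProductSpace

noncomputable section

/-- If a nonnegative convex function on the plane vanishes on a horizontal segment, its one-sided
vertical derivative is the same constant at all interior points of that segment. -/
theorem ConvexOn.exists_slope_bound {v : ℝ × ℝ → ℝ} (hv : ConvexOn ℝ univ v) {a ε : ℝ}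
    (ha : 0 < a) (hε : 0 < ε) (hnonneg : ∀ x, 0 ≤ v x) (hzero : ∀ s, |s| ≤ a → v (s, 0) = 0) :
    ∃ c : ℝ, (∀ s t, |s| < a → 0 < t → c * t ≤ v (s, t)) ∧
      ∀ s, |s| < a → ∃ T > 0, ∀ t, 0 ≤ t → t ≤ T → v (s, t) ≤ (c + ε) * t := by
  set S : Set ℝ := {r | ∃ s t, |s| < a ∧ 0 < t ∧ r = v (s, t) / t} with hS
  have hbdd : BddBelow S := by
    refine ⟨0, ?_⟩
    rintro r ⟨s, t, -, ht, rfl⟩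
    exact div_nonneg (hnonneg _) ht.le
  have hne : S.Nonempty := ⟨_, 0, 1, by simpa using ha, one_pos, rfl⟩
  refine ⟨sInf S, fun s t hs ht => ?_, fun s hs => ?_⟩
  · rw [← le_div_iff₀ ht]
    exact csInf_le hbdd ⟨s, t, hs, ht, rfl⟩
  obtain ⟨r, ⟨s', t', hs', ht', rfl⟩, hr⟩ := exists_lt_of_csInf_lt hne
    (lt_add_of_pos_right (sInf S) hε)
  rw [div_lt_iff₀ ht'] at hr
  set l : ℝ := (a - |s|) / (2 * a) with hl
  have hs0 := abs_nonneg s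
  have hl0 : 0 < l := by rw [hl]; exact div_pos (by linarith) (by linarith)
  have hla : l * (2 * a) = a - |s| := by rw [hl]; field_simp
  have hl1 : l ≤ 1 / 2 := by
    by_contra! h
    nlinarith
  refine ⟨l * t', by positivity, fun t ht htT => ?_⟩
  set k : ℝ := t / t' with hk
  have hkt : k * t' = t := by rw [hk]; field_simp
  have hk0 : 0 ≤ k := by positivity
  have hkl : k ≤ l := by rw [hk, div_le_iff₀ ht']; exact htT
  have hk1 : 0 < 1 - k := by linarith
  set σ : ℝ := (s - k * s') / (1 - k) with hσ
  have hσe : (1 - k) * σ = s - k * s' := by rw [hσ]; field_simp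
  have hσa : |σ| ≤ a := by
    rw [hσ, abs_div, abs_of_pos hk1, div_le_iff₀ hk1]
    have h1 : |s - k * s'| ≤ |s| + k * |s'| := by
      have := abs_sub s (k * s')
      rwa [abs_mul, abs_of_nonneg hk0] at this
    nlinarith
  have h := hv.2 (mem_univ (σ, (0 : ℝ))) (mem_univ (s', t')) hk1.le hk0 (by ring)
  have e : (1 - k) • (σ, (0 : ℝ)) + k • (s', t') = (s, t) := by
    ext <;> simp <;> linarith
  rw [e, hzero σ hσa] at h
  simp only [smul_eq_mul, mul_zero, zero_add] at h
  calc v (s, t) ≤ k * v (s', t') := h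
    _ ≤ k * ((sInf S + ε) * t') := by gcongr
    _ = (sInf S + ε) * t := by rw [← hkt]; ring

/-- Near a horizontal segment on which a nonnegative convex function vanishes, the subgradients at
height of order `t` above the segment lie in a box with sides `O(ε * t)` and `ε`. -/
theorem ConvexOn.exists_subgradient_bound {v : ℝ × ℝ → ℝ} (hv : ConvexOn ℝ univ v) {a ε δ : ℝ}
    (ha : 0 < a) (hε : 0 < ε) (hδ : 0 < δ) (hnonneg : ∀ x, 0 ≤ v x)
    (hzero : ∀ s, |s| ≤ a → v (s, 0) = 0) :
    ∃ c t : ℝ, 0 < t ∧ t ≤ δ ∧ ∀ s y q₁ q₂ : ℝ, |s| ≤ a / 4 → t / 2 ≤ y → y ≤ t →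
      (∀ s' y', v (s, y) + (q₁ * (s' - s) + q₂ * (y' - y)) ≤ v (s', y')) →
      |q₁| ≤ 4 * ε * t / a ∧ c ≤ q₂ ∧ q₂ ≤ c + ε := by
  obtain ⟨c, hc, hcε⟩ := hv.exists_slope_bound ha (half_pos hε) hnonneg hzero
  obtain ⟨T₁, hT₁, h₁⟩ := hcε (a / 2) (by rw [abs_of_pos] <;> linarith)
  obtain ⟨T₂, hT₂, h₂⟩ := hcε (-(a / 2)) (by rw [abs_neg, abs_of_pos] <;> linarith)
  set t : ℝ := min δ (min T₁ T₂ / 2) with ht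
  have ht0 : 0 < t := by positivity
  have htδ : t ≤ δ := min_le_left _ _
  have htT : 2 * t ≤ min T₁ T₂ := by linarith [min_le_right δ (min T₁ T₂ / 2)]
  have htT₁ := htT.trans (min_le_left _ _)
  have htT₂ := htT.trans (min_le_right _ _)
  have hup : ∀ s y, |s| ≤ a / 2 → 0 ≤ y → y ≤ 2 * t → v (s, y) ≤ c * y + ε * t := by
    intro s y hs hy hyt
    rw [abs_le] at hs
    have h := hv.2 (mem_univ (-(a / 2), y)) (mem_univ (a / 2, y))
      (show 0 ≤ (a / 2 - s) / a from div_nonneg (by linarith) ha.le)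
      (show 0 ≤ (a / 2 + s) / a from div_nonneg (by linarith) ha.le) (by field_simp; ring)
    have e : ((a / 2 - s) / a) • (-(a / 2), y) + ((a / 2 + s) / a) • (a / 2, y) = (s, y) := by
      ext <;> simp <;> field_simp <;> ring
    rw [e] at h
    have g₁ := h₁ y hy (hyt.trans htT₁)
    have g₂ := h₂ y hy (hyt.trans htT₂)
    calc v (s, y) ≤ _ := h
      _ ≤ ((a / 2 - s) / a) • ((c + ε / 2) * y) + ((a / 2 + s) / a) • ((c + ε / 2) * y) := by
        have p₁ : 0 ≤ (a / 2 - s) / a := div_nonneg (by linarith) ha.le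
        have p₂ : 0 ≤ (a / 2 + s) / a := div_nonneg (by linarith) ha.le
        simp only [smul_eq_mul]
        gcongr
      _ = (c + ε / 2) * y := by simp only [smul_eq_mul]; field_simp; ring
      _ ≤ c * y + ε * t := by nlinarith
  refine ⟨c, t, ht0, htδ, fun s y q₁ q₂ hs hy hyt hq => ?_⟩
  have hy0 : 0 < y := by linarith
  have hs' := abs_le.1 hs
  have hlow := hc s y (by linarith) hy0
  refine ⟨?_, ?_, ?_⟩
  · have k₁ := hq (s + a / 4) y
    have k₂ := hq (s - a / 4) y
    have u₁ := hup (s + a / 4) y (abs_le.2 ⟨by linarith, by linarith⟩) hy0.le (by linarith)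
    have u₂ := hup (s - a / 4) y (abs_le.2 ⟨by linarith, by linarith⟩) hy0.le (by linarith)
    rw [le_div_iff₀ ha]
    have : |q₁| * a = |q₁ * a| := by rw [abs_mul, abs_of_pos ha]
    rw [this, abs_le]
    constructor <;> nlinarith
  · have k := hq s 0
    rw [hzero s (by linarith)] at k
    have : c * y ≤ q₂ * y := by linarith
    exact le_of_mul_le_mul_right this hy0
  · have k := hq s (2 * t)
    have u := hup s (2 * t) (by linarith) (by linarith) le_rfl
    by_contra! hcon
    nlinarith

theorem ConvexOn.gradient_mem_subdiff {u : E2 → ℝ} (hu : ConvexOn ℝ univ u) {x : E2}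
    (hx : DifferentiableAt ℝ u x) : gradient u x ∈ subdiff u x := by
  intro z
  have hg : ConvexOn ℝ univ (u ∘ AffineMap.lineMap (k := ℝ) x z) := by
    simpa using hu.comp_affineMap (AffineMap.lineMap (k := ℝ) x z)
  have hd : HasDerivAt (u ∘ AffineMap.lineMap (k := ℝ) x z) (⟪gradient u x, z - x⟫) 0 := by
    have h₁ : HasFDerivAt u (InnerProductSpace.toDual ℝ E2 (gradient u x))
        (AffineMap.lineMap (k := ℝ) x z 0) := by
      simpa using hx.hasGradientAt.hasFDerivAt
    simpa using h₁.comp_hasDerivAt (0 : ℝ) AffineMap.hasDerivAt_lineMap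
  have h := hg.le_slope_of_hasDerivAt (mem_univ 0) (mem_univ 1) one_pos hd
  simp only [slope_def_field, Function.comp_apply, AffineMap.lineMap_apply_one,
    AffineMap.lineMap_apply_zero, sub_zero, div_one] at h
  linarith

theorem OrthonormalBasis.volume_repr_box (B : OrthonormalBasis (Fin 2) ℝ E2) (x : E2)
    {a₀ b₀ a₁ b₁ : ℝ} :
    volume {y : E2 | ⟪y - x, B 0⟫ ∈ Icc a₀ b₀ ∧ ⟪y - x, B 1⟫ ∈ Icc a₁ b₁} =
      ENNReal.ofReal (b₀ - a₀) * ENNReal.ofReal (b₁ - a₁) := by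
  have hmp : MeasurePreserving (fun y : E2 => WithLp.ofLp (B.repr (y - x))) volume volume :=
    (PiLp.volume_preserving_ofLp (Fin 2)).comp
      (B.measurePreserving_repr.comp (measurePreserving_sub_right volume x))
  have h := hmp.measure_preimage
    (measurableSet_Icc (a := (![a₀, a₁] : Fin 2 → ℝ)) (b := ![b₀, b₁])).nullMeasurableSet
  rw [Real.volume_Icc_pi] at h
  simp only [Fin.prod_univ_two, Matrix.cons_val_zero, Matrix.cons_val_one] at h
  rw [← h]
  congr 1
  ext y
  simp only [mem_ofPred_eq, mem_preimage, mem_Icc, Pi.le_def, Fin.forall_fin_two,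
    B.repr_apply_apply, real_inner_comm (y - x), Matrix.cons_val_zero, Matrix.cons_val_one]
  tauto

theorem measurableSet_repr_box (B : OrthonormalBasis (Fin 2) ℝ E2) (x : E2) (a₀ b₀ a₁ b₁ : ℝ) :
    MeasurableSet {y : E2 | ⟪y - x, B 0⟫ ∈ Icc a₀ b₀ ∧ ⟪y - x, B 1⟫ ∈ Icc a₁ b₁} := by
  have h : ∀ i, Continuous fun y : E2 => ⟪y - x, B i⟫ := fun i => by fun_prop
  exact ((isClosed_Icc.preimage (h 0)).inter (isClosed_Icc.preimage (h 1))).measurableSet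

theorem exists_orthonormalBasis_fin_two {e : E2} (he : ‖e‖ = 1) :
    ∃ B : OrthonormalBasis (Fin 2) ℝ E2, B 0 = e := by
  have ho : Orthonormal ℝ (({0} : Set (Fin 2)).domRestrict fun _ : Fin 2 => e) :=
    ⟨fun _ => he, fun i j hij => absurd (Subsingleton.elim i j) hij⟩
  obtain ⟨B, hB⟩ := ho.exists_orthonormalBasis_extension_of_card_eq (by simp)
  exact ⟨B, hB 0 rfl⟩

/-- A planar convex function whose Monge-Ampère measure dominates the Lebesgue measure is strictly
convex: a subgradient at a point of `Ω` is not a subgradient at any other point. -/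
theorem eq_of_mem_subdiff_of_volume_le {Ω : Set E2} (hΩ : IsOpen Ω) {u : E2 → ℝ}
    (hu : ConvexOn ℝ univ u) (hdiff : ∀ᵐ x : E2, DifferentiableAt ℝ u x)
    (hvol : ∀ Q : Set E2, MeasurableSet Q →
      volume {x ∈ Ω | DifferentiableAt ℝ u x ∧ gradient u x ∈ Q} ≤ volume Q)
    {p x₀ x₁ : E2} (hx₀ : x₀ ∈ Ω) (h₀ : p ∈ subdiff u x₀) (h₁ : p ∈ subdiff u x₁) :
    x₀ = x₁ := by
  by_contra hne
  obtain ⟨r, hr, hball⟩ := Metric.isOpen_iff.1 hΩ x₀ hx₀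
  set d : ℝ := ‖x₁ - x₀‖ with hd
  have hd0 : 0 < d := norm_pos_iff.2 (sub_ne_zero.2 (Ne.symm hne))
  set e : E2 := d⁻¹ • (x₁ - x₀) with he
  have hde : d • e = x₁ - x₀ := by rw [he, smul_smul, mul_inv_cancel₀ hd0.ne', one_smul]
  have he1 : ‖e‖ = 1 := by
    rw [he, norm_smul, norm_inv, Real.norm_of_nonneg hd0.le, ← hd, inv_mul_cancel₀ hd0.ne']
  obtain ⟨B, hB⟩ := exists_orthonormalBasis_fin_two he1
  set a : ℝ := min r d / 4 with ha
  have ha0 : 0 < a := by positivity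
  have har : 4 * a ≤ r := by linarith [min_le_left r d]
  have had : 4 * a ≤ d := by linarith [min_le_right r d]
  set z : E2 := x₀ + a • e with hz
  set v : ℝ × ℝ → ℝ := fun q =>
    u (z + q.1 • B 0 + q.2 • B 1) - u x₀ - ⟪p, z + q.1 • B 0 + q.2 • B 1 - x₀⟫ with hvdef
  have hnonneg : ∀ q, 0 ≤ v q := fun q => by
    have := h₀ (z + q.1 • B 0 + q.2 • B 1)
    simp only [hvdef]; linarith
  have hv : ConvexOn ℝ univ v := by
    refine ⟨convex_univ, fun q _ q' _ k l hk hl hkl => ?_⟩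
    have h := hu.2 (mem_univ (z + q.1 • B 0 + q.2 • B 1))
      (mem_univ (z + q'.1 • B 0 + q'.2 • B 1)) hk hl hkl
    have ez : k • (z + q.1 • B 0 + q.2 • B 1) + l • (z + q'.1 • B 0 + q'.2 • B 1) =
        z + (k • q + l • q').1 • B 0 + (k • q + l • q').2 • B 1 := by
      have : z = (k + l) • z := by rw [hkl, one_smul]
      conv_rhs => rw [this]
      simp only [Prod.fst_add, Prod.snd_add, Prod.smul_fst, Prod.smul_snd, smul_eq_mul]
      module
    have ei : ⟪p, k • (z + q.1 • B 0 + q.2 • B 1) + l • (z + q'.1 • B 0 + q'.2 • B 1) - x₀⟫ =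
        k * ⟪p, z + q.1 • B 0 + q.2 • B 1 - x₀⟫ + l * ⟪p, z + q'.1 • B 0 + q'.2 • B 1 - x₀⟫ := by
      simp only [inner_sub_right, inner_add_right, inner_smul_right]
      linear_combination ⟪p, x₀⟫ * hkl
    rw [ez] at h ei
    simp only [hvdef, ei, smul_eq_mul] at h ⊢
    linear_combination h + (u x₀) * hkl
  have hzero : ∀ s, |s| ≤ a → v (s, 0) = 0 := by
    intro s hs
    rw [abs_le] at hs
    refine le_antisymm ?_ (hnonneg _)
    have h := hu.2 (mem_univ x₀) (mem_univ x₁)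
      (show 0 ≤ 1 - (a + s) / d from sub_nonneg.2 ((div_le_one hd0).2 (by linarith)))
      (show 0 ≤ (a + s) / d from div_nonneg (by linarith) hd0.le) (by ring)
    have hx₁ : x₁ = x₀ + d • e := by rw [hde]; abel
    have ez : (1 - (a + s) / d) • x₀ + ((a + s) / d) • x₁ = z + s • B 0 + (0 : ℝ) • B 1 := by
      have hdd : ((a + s) / d) • d • e = (a + s) • e := by
        rw [smul_smul, div_mul_cancel₀ _ hd0.ne']
      rw [hB, hz, hx₁, smul_add, hdd]
      module
    have ei : z + s • B 0 + (0 : ℝ) • B 1 - x₀ = ((a + s) / d) • (x₁ - x₀) := by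
      rw [← ez]; module
    have hle := h₁ x₀
    rw [← neg_sub x₁ x₀, inner_neg_right] at hle
    rw [ez] at h
    simp only [hvdef, ei, inner_smul_right, smul_eq_mul] at h ⊢
    have hk : 0 ≤ (a + s) / d := div_nonneg (by linarith) hd0.le
    nlinarith
  obtain ⟨c, t, ht0, hta, hbd⟩ := hv.exists_subgradient_bound ha0 (ε := a / 8) (by positivity) ha0
    hnonneg hzero
  set E : Set E2 := {y | ⟪y - z, B 0⟫ ∈ Icc (-(a / 4)) (a / 4) ∧ ⟪y - z, B 1⟫ ∈ Icc (t / 2) t}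
    with hE
  set Q : Set E2 := {q | ⟪q - p, B 0⟫ ∈ Icc (-(4 * (a / 8) * t / a)) (4 * (a / 8) * t / a) ∧
    ⟪q - p, B 1⟫ ∈ Icc c (c + a / 8)} with hQ
  have hcoord : ∀ y : E2, z + ⟪y - z, B 0⟫ • B 0 + ⟪y - z, B 1⟫ • B 1 = y := fun y => by
    have := B.sum_repr' (y - z)
    rw [Fin.sum_univ_two] at this
    rw [real_inner_comm, real_inner_comm (B 1), add_assoc, this]; abel
  have hEΩ : E ⊆ Ω := by
    rintro y ⟨hy₀, hy₁⟩
    refine hball (mem_ball_iff_norm.2 ?_)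
    have : y - x₀ = a • e + ⟪y - z, B 0⟫ • B 0 + ⟪y - z, B 1⟫ • B 1 := by
      conv_lhs => rw [← hcoord y, hz]
      abel
    rw [this]
    have n₀ : ‖⟪y - z, B 0⟫ • B 0‖ ≤ a / 4 := by
      rw [norm_smul, B.norm_eq_one, mul_one]; exact abs_le.2 hy₀
    have n₁ : ‖⟪y - z, B 1⟫ • B 1‖ ≤ a := by
      rw [norm_smul, B.norm_eq_one, mul_one]
      exact abs_le.2 ⟨by linarith [hy₁.1], by linarith [hy₁.2]⟩
    have n₂ : ‖a • e‖ = a := by rw [norm_smul, he1, mul_one, Real.norm_of_nonneg ha0.le]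
    linarith [norm_add₃_le (a := a • e) (b := ⟪y - z, B 0⟫ • B 0) (c := ⟪y - z, B 1⟫ • B 1)]
  have hEQ : ∀ y ∈ E, DifferentiableAt ℝ u y → gradient u y ∈ Q := by
    rintro y ⟨hy₀, hy₁⟩ hy
    have hsub := hu.gradient_mem_subdiff hy
    have := hbd _ _ ⟪gradient u y - p, B 0⟫ ⟪gradient u y - p, B 1⟫ (abs_le.2 hy₀) hy₁.1 hy₁.2 ?_
    · exact ⟨abs_le.1 this.1, this.2⟩
    intro s' y'
    have h := hsub (z + s' • B 0 + y' • B 1)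
    have e₁ : z + s' • B 0 + y' • B 1 - y =
        (s' - ⟪y - z, B 0⟫) • B 0 + (y' - ⟪y - z, B 1⟫) • B 1 := by
      conv_lhs => rw [← hcoord y]
      module
    have e₂ : z + s' • B 0 + y' • B 1 - x₀ = (z + s' • B 0 + y' • B 1 - y) + (y - x₀) := by abel
    simp only [hvdef, hcoord y]
    rw [e₂, inner_add_right, e₁]
    rw [e₁] at h
    simp only [inner_add_right, inner_smul_right, inner_sub_left (gradient u y)] at h ⊢
    linarith
  have hle : volume E ≤ volume Q := by
    refine le_trans (measure_mono_ae ?_) (hvol Q (measurableSet_repr_box B p _ _ _ _))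
    filter_upwards [hdiff] with y hy hyE
    exact ⟨hEΩ hyE, hy, hEQ y hyE hy⟩
  rw [hE, hQ, B.volume_repr_box, B.volume_repr_box, ← ENNReal.ofReal_mul (by linarith),
    ← ENNReal.ofReal_mul (by ring_nf; positivity), ENNReal.ofReal_le_ofReal_iff
    (by ring_nf; positivity)] at hle
  have hat : 0 < a * t := by positivity
  have e4 : 4 * (a / 8) * t / a = t / 2 := by field_simp; ring
  rw [e4] at hle
  nlinarith

/-- `S₁`, the set of singular points whose subdifferential contains a vertex
of the polygon `Ω*`, is finite with cardinality at most `m`. -/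
theorem sigma_one_finite
    (Ω Ωs : Set E2)
    (hΩo : IsOpen Ω) (hΩb : Bornology.IsBounded Ω) (hΩc : IsConnected Ω)
    (hΩso : IsOpen Ωs) (hΩsb : Bornology.IsBounded Ωs) (hΩsc : IsConnected Ωs)
    (hΩsnc : ¬ Convex ℝ Ωs)
    (m : ℕ) [NeZero m] (b : Fin m → E2) (hbinj : Function.Injective b)
    (hpoly : frontier Ωs = ⋃ i : Fin m, segment ℝ (b i) (b (i + 1)))
    (hvol : volume Ω = volume Ωs)
    (u : E2 → ℝ) (hconv : ConvexOn ℝ Set.univ u)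
    (K : ℝ≥0) (hLip : LipschitzWith K u)
    (hae : ∀ᵐ x : E2, DifferentiableAt ℝ u x ∧ gradient u x ∈ closure Ωs)
    (hpush : ∀ E : Set E2, MeasurableSet E →
      volume {x ∈ Ω | DifferentiableAt ℝ u x ∧ gradient u x ∈ E} = volume (E ∩ Ωs))
    (A : Set E2) (hA : A = {x ∈ Ω | ¬ DifferentiableAt ℝ u x})
    (S₁ S₂ S₂' S₂'' : Set E2)
    (hS₁ : S₁ = {x ∈ A | ∃ i : Fin m, b i ∈ subdiff u x})
    (hS₂ : S₂ = A \ S₁)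
    (hS₂' : S₂' = {x ∈ S₂ |
      {i : Fin m | (subdiff u x ∩ openSegment ℝ (b i) (b (i + 1))).Nonempty}.ncard = 2})
    (hS₂'' : S₂'' = S₂ \ S₂')
 :
    S₁.Finite ∧ S₁.ncard ≤ m := by
  subst hS₁ hA
  have hvolQ : ∀ Q : Set E2, MeasurableSet Q →
      volume {x ∈ Ω | DifferentiableAt ℝ u x ∧ gradient u x ∈ Q} ≤ volume Q := fun Q hQ =>
    (hpush Q hQ).trans_le (measure_mono inter_subset_left)
  have hdiff : ∀ᵐ x : E2, DifferentiableAt ℝ u x := hae.mono fun _ h => h.1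
  have hex : ∀ x, ∃ i : Fin m, (∃ j, b j ∈ subdiff u x) → b i ∈ subdiff u x := fun x => by
    by_cases h : ∃ j, b j ∈ subdiff u x
    · exact h.imp fun i hi _ => hi
    · exact ⟨0, fun h' => absurd h' h⟩
  choose f hf using hex
  have hinj : InjOn f {x ∈ {x ∈ Ω | ¬ DifferentiableAt ℝ u x} | ∃ i : Fin m, b i ∈ subdiff u x} := by
    rintro x ⟨hx, hxb⟩ y ⟨-, hyb⟩ hxy
    exact eq_of_mem_subdiff_of_volume_le hΩo hconv hdiff hvolQ hx.1 (hf x hxb)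
      (hxy ▸ hf y hyb)
  refine ⟨Set.Finite.of_injOn (mapsTo_univ f _) hinj finite_univ, ?_⟩
  simpa [Set.ncard_univ] using ncard_le_ncard_of_injOn f (mapsTo_univ f _) hinj finite_univ
end
end

section
/- Let v : ℝ² → ℝ be a convex function, e ∈ ℝ² a unit vector, and x_0, y_0 ∈ ℝ². If x_0 ∈ ∂⁻v(y_0 + t·e) for every t ≥ 0, then for every y ∈ ℝ² and every x ∈ ∂⁻v(y) one has ⟨x − x_0, e⟩ ≤ 0; in particular ∂⁻v(ℝ²) ⊂ {x ∈ ℝ² : ⟨x − x_0, e⟩ ≤ 0}. -/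
open MeasureTheory Metric Set
open scoped NNReal ENNReal RealInnerProductSpace

noncomputable section

/-- if `x₀ ∈ ∂⁻v(y₀ + t e)` for all `t ≥ 0`, then every subgradient `x` of
`v` anywhere satisfies `⟪x - x₀, e⟫ ≤ 0`; in particular `∂⁻v(ℝ²)` lies in the half-plane
`{⟪· - x₀, e⟫ ≤ 0}`. -/
theorem subgradient_halfplane
    (v : E2 → ℝ) (hconv : ConvexOn ℝ Set.univ v)
    (e : E2) (he : ‖e‖ = 1) (x₀ y₀ : E2)
    (h : ∀ t : ℝ, 0 ≤ t → x₀ ∈ subdiff v (y₀ + t • e)) :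
    (∀ y : E2, ∀ x ∈ subdiff v y, ⟪x - x₀, e⟫ ≤ 0) ∧
    (⋃ y : E2, subdiff v y) ⊆ {x : E2 | ⟪x - x₀, e⟫ ≤ 0} := by
  have key : ∀ y : E2, ∀ x ∈ subdiff v y, ⟪x - x₀, e⟫ ≤ 0 := by
    intro y x hx
    by_contra! ha
    have ray_bound : ∀ t : ℝ, 0 ≤ t → t * ⟪x - x₀, e⟫ ≤ ⟪x - x₀, y - y₀⟫ := by
      intro t ht
      have h₁ := h t ht y
      have h₂ := hx (y₀ + t • e)
      simp only [inner_sub_left, inner_sub_right, inner_add_right, inner_smul_right] at h₁ h₂ ⊢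
      linarith
    have hlarge := ray_bound ((|⟪x - x₀, y - y₀⟫| + 1) / ⟪x - x₀, e⟫) (by positivity)
    rw [div_mul_cancel₀ _ ha.ne'] at hlarge
    linarith [le_abs_self ⟪x - x₀, y - y₀⟫]
  exact ⟨key, iUnion_subset key⟩
end
end
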